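/- arXiv:1603.05639 — 2 statements merged into one kernel-verified Lean document; each statement's English description precedes it below -/
import Mathlib

section
/- There exists a positive constant c1 such that for every connected Eulerian digraph G on n vertices and m directed edges, the lazy simple random walk on G satisfies t_unif ≤ c1·m·n; that is, for every integer t ≥ c1·m·n and all vertices x,y, |P^t(x,y)/π(y) − 1| ≤ 1/4. -/
open Finset

/-- The out-degree of a vertex in a digraph. -/
def dout {V : Type} [Fintype V] (E : V → V → Prop) [DecidableRel E] (x : V) : ℕ :=
  (Finset.univ.filter fun y => E x y).card

/-- The in-degree of a vertex in a digraph. -/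
def din {V : Type} [Fintype V] (E : V → V → Prop) [DecidableRel E] (x : V) : ℕ :=
  (Finset.univ.filter fun y => E y x).card

/-- The number of directed edges of a digraph. -/
def numEdges {V : Type} [Fintype V] (E : V → V → Prop) [DecidableRel E] : ℕ :=
  ∑ x, dout E x

/-- The transition matrix of the lazy simple random walk on a digraph. -/
noncomputable def lazyP {V : Type} [Fintype V] [DecidableEq V] (E : V → V → Prop)
    [DecidableRel E] : Matrix V V ℝ :=
  fun v w => if v = w then 1 / 2 else if E v w then 1 / (2 * (dout E v : ℝ)) else 0

/-- The stationary distribution `π(v) = d_out(v)/m` of the lazy walk on an Eulerian digraph. -/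
noncomputable def statDist {V : Type} [Fintype V] (E : V → V → Prop) [DecidableRel E]
    (v : V) : ℝ :=
  (dout E v : ℝ) / (numEdges E : ℝ)

section EulerianWalk

variable {V : Type} [Fintype V] {E : V → V → Prop} [DecidableRel E]

/-- The unnormalised Dirichlet energy `∑ (f v - f w) ^ 2` over the directed edges. -/
def edgeEnergy (E : V → V → Prop) [DecidableRel E] (f : V → ℝ) : ℝ :=
  ∑ v, ∑ w with E v w, (f v - f w) ^ 2

/-- The squared difference of a function along an unordered pair. -/
def sqDiff {V : Type} (f : V → ℝ) : Sym2 V → ℝ :=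
  Sym2.lift ⟨fun a b => (f a - f b) ^ 2, fun a b => by ring⟩

lemma sqDiff_nonneg {V : Type} (f : V → ℝ) (e : Sym2 V) : 0 ≤ sqDiff f e := by
  induction e with | _ a b => exact sq_nonneg _

lemma sq_sub_le_length_mul {V : Type} {G : SimpleGraph V} (f : V → ℝ) {a b : V} (p : G.Walk a b) :
    (f a - f b) ^ 2 ≤ p.length * (p.edges.map (sqDiff f)).sum := by
  induction p with
  | nil => simp
  | @cons u v w h p ih =>
    have hS : 0 ≤ (p.edges.map (sqDiff f)).sum :=
      List.sum_nonneg fun x hx => by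
        obtain ⟨e, -, rfl⟩ := List.mem_map.1 hx
        exact sqDiff_nonneg f e
    have hl : (0 : ℝ) ≤ p.length := Nat.cast_nonneg _
    simp only [SimpleGraph.Walk.length_cons, SimpleGraph.Walk.edges_cons, List.map_cons,
      List.sum_cons, Nat.cast_add, Nat.cast_one]
    have hx : sqDiff f s(u, v) = (f u - f v) ^ 2 := rfl
    rw [hx]
    generalize (p.edges.map (sqDiff f)).sum = S at *
    generalize (p.length : ℝ) = l at *
    have key : 2 * (f u - f v) * (f v - f w) ≤ l * (f u - f v) ^ 2 + S := by
      refine abs_le_of_sq_le_sq' ?_ (by positivity) |>.2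
      nlinarith [mul_le_mul_of_nonneg_left ih (sq_nonneg (f u - f v)),
        sq_nonneg (l * (f u - f v) ^ 2 - S)]
    nlinarith

lemma sq_sub_le_card_mul_edgeEnergy [DecidableEq V] (hconn : (SimpleGraph.fromRel E).Connected)
    (f : V → ℝ) (a b : V) : (f a - f b) ^ 2 ≤ Fintype.card V * edgeEnergy E f := by
  obtain ⟨p, hp⟩ := (hconn.preconnected a b).exists_isPath
  have hS : (p.edges.map (sqDiff f)).sum ≤ edgeEnergy E f := by
    rw [← List.sum_toFinset _ hp.isTrail.edges_nodup]
    calc ∑ e ∈ p.edges.toFinset, sqDiff f e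
        ≤ ∑ e ∈ (univ.filter fun q : V × V => E q.1 q.2).image (fun q => s(q.1, q.2)),
            sqDiff f e := by
          refine sum_le_sum_of_subset_of_nonneg ?_ fun e _ _ => sqDiff_nonneg f e
          intro e he
          have he' := p.edges_subset_edgeSet (List.mem_toFinset.1 he)
          induction e with | _ c d =>
          rw [SimpleGraph.mem_edgeSet, SimpleGraph.fromRel_adj] at he'
          rcases he'.2 with h | h
          · exact mem_image.2 ⟨(c, d), by simpa using h, rfl⟩
          · exact mem_image.2 ⟨(d, c), by simpa using h, Sym2.eq_swap⟩
      _ ≤ ∑ q : V × V with E q.1 q.2, sqDiff f s(q.1, q.2) :=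
          sum_image_le_of_nonneg fun e _ => sqDiff_nonneg f e
      _ = edgeEnergy E f := by
          simp only [edgeEnergy, sum_filter, Fintype.sum_prod_type]
          rfl
  have hE : 0 ≤ edgeEnergy E f := sum_nonneg fun _ _ => sum_nonneg fun _ _ => sq_nonneg _
  refine (sq_sub_le_length_mul f p).trans ?_
  have hl : (p.length : ℝ) ≤ Fintype.card V := by exact_mod_cast hp.length_lt.le
  calc (p.length : ℝ) * (p.edges.map (sqDiff f)).sum ≤ p.length * edgeEnergy E f := by gcongr
    _ ≤ _ := by gcongr

/-- In an Eulerian digraph, summing over edges by head or by tail gives the same weights. -/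
lemma sum_edges_head (heul : ∀ x, dout E x = din E x) (f : V → ℝ) :
    ∑ v, ∑ w with E v w, f w = ∑ v, (dout E v : ℝ) * f v := by
  simp only [sum_filter]
  rw [sum_comm]
  refine sum_congr rfl fun w _ => ?_
  rw [heul, din, ← sum_filter, sum_const, nsmul_eq_mul]

lemma sum_edges_tail (f : V → ℝ) :
    ∑ v, ∑ w with E v w, f v = ∑ v, (dout E v : ℝ) * f v := by
  simp [dout]

lemma dout_pos (heul : ∀ x, dout E x = din E x)
    (hconn : (SimpleGraph.fromRel E).Connected) (hloop : ∀ x, ¬ E x x) (hm : 0 < numEdges E)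
    (v : V) : 0 < dout E v := by
  have hnt : Nontrivial V := by
    obtain ⟨x, -, hx⟩ := exists_ne_zero_of_sum_ne_zero hm.ne'
    obtain ⟨y, hy⟩ := card_pos.1 (Nat.pos_of_ne_zero hx)
    exact ⟨x, y, fun h => hloop x (by simpa [← h] using hy)⟩
  obtain ⟨w, hw⟩ := hconn.preconnected.exists_adj_of_nontrivial v
  rw [SimpleGraph.fromRel_adj] at hw
  rcases hw.2 with h | h
  · exact card_pos.2 ⟨w, by simpa using h⟩
  · rw [heul]
    exact card_pos.2 ⟨w, by simpa using h⟩

variable [DecidableEq V]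

lemma dout_mul_lazyP_mulVec (hloop : ∀ x, ¬ E x x) (hpos : ∀ v, 0 < dout E v)
    (f : V → ℝ) (v : V) :
    dout E v * (∑ w, lazyP E v w * f w) = ∑ w with E v w, (f v + f w) / 2 := by
  have hd : (dout E v : ℝ) ≠ 0 := by exact_mod_cast (hpos v).ne'
  have hP : ∀ w, lazyP E v w * f w =
      (if v = w then f w / 2 else 0) + (if E v w then f w / (2 * dout E v) else 0) := by
    intro w
    unfold lazyP
    by_cases h : v = w
    · subst h
      simp [hloop]
      ring
    · simp only [h, if_false]
      split_ifs <;> ring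
  simp only [hP, sum_add_distrib, sum_ite_eq, mem_univ, if_true, ← sum_filter, ← sum_div]
  rw [sum_const, nsmul_eq_mul, ← dout]
  field_simp

lemma sum_dout_mul_lazyP_mulVec (hloop : ∀ x, ¬ E x x) (heul : ∀ x, dout E x = din E x)
    (hpos : ∀ v, 0 < dout E v) (f : V → ℝ) :
    ∑ v, dout E v * (∑ w, lazyP E v w * f w) = ∑ v, dout E v * f v := by
  simp only [dout_mul_lazyP_mulVec hloop hpos, ← sum_div, sum_add_distrib]
  rw [sum_edges_head heul, sum_edges_tail]
  ring

/-- One step of the lazy walk decreases the weighted `ℓ²` norm by a quarter of the energy. -/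
lemma sum_dout_mul_sq_lazyP_mulVec_le (hloop : ∀ x, ¬ E x x) (heul : ∀ x, dout E x = din E x)
    (hpos : ∀ v, 0 < dout E v) (f : V → ℝ) :
    ∑ v, dout E v * (∑ w, lazyP E v w * f w) ^ 2 ≤
      ∑ v, dout E v * f v ^ 2 - edgeEnergy E f / 4 := by
  have h1 : ∀ v, dout E v * (∑ w, lazyP E v w * f w) ^ 2 ≤
      ∑ w with E v w, ((f v + f w) / 2) ^ 2 := by
    intro v
    have hd : (0 : ℝ) < dout E v := by exact_mod_cast hpos v
    have hcs := sq_sum_le_card_mul_sum_sq (s := univ.filter fun w => E v w)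
      (f := fun w => (f v + f w) / 2)
    rw [← dout_mul_lazyP_mulVec hloop hpos, ← dout] at hcs
    refine le_of_mul_le_mul_left ?_ hd
    linarith
  refine (sum_le_sum fun v _ => h1 v).trans_eq ?_
  have h2 : ∀ v w, ((f v + f w) / 2) ^ 2 =
      f v ^ 2 / 2 + f w ^ 2 / 2 - (f v - f w) ^ 2 / 4 := fun v w => by ring
  simp only [h2, sum_add_distrib, sum_sub_distrib, ← sum_div, edgeEnergy]
  rw [sum_edges_head heul fun w => f w ^ 2, sum_edges_tail fun v => f v ^ 2]
  ring

lemma lazyP_nonneg (v w : V) : 0 ≤ lazyP E v w := by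
  unfold lazyP
  split_ifs <;> positivity

lemma lazyP_pow_nonneg (t : ℕ) (v w : V) : 0 ≤ (lazyP E ^ t) v w := by
  induction t generalizing v with
  | zero => simp only [pow_zero, Matrix.one_apply]; split_ifs <;> norm_num
  | succ t ih =>
    rw [pow_succ', Matrix.mul_apply]
    exact sum_nonneg fun z _ => mul_nonneg (lazyP_nonneg v z) (ih z)

/-- The density at time `t` of the walk with respect to its stationary distribution, as a
function of the starting vertex. -/
noncomputable def density (E : V → V → Prop) [DecidableRel E] (t : ℕ) (y z : V) : ℝ :=
  (lazyP E ^ t) z y / statDist E y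

lemma density_succ (t : ℕ) (y z : V) :
    density E (t + 1) y z = ∑ w, lazyP E z w * density E t y w := by
  simp only [density, pow_succ', Matrix.mul_apply, sum_div, mul_div_assoc]

lemma density_nonneg (t : ℕ) (y z : V) : 0 ≤ density E t y z :=
  div_nonneg (lazyP_pow_nonneg t z y) (by unfold statDist; positivity)

lemma sum_dout_mul_density (hloop : ∀ x, ¬ E x x) (heul : ∀ x, dout E x = din E x)
    (hpos : ∀ v, 0 < dout E v) (t : ℕ) (y : V) :
    ∑ z, dout E z * density E t y z = numEdges E := by
  induction t with
  | zero =>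
    have hd : (dout E y : ℝ) ≠ 0 := by exact_mod_cast (hpos y).ne'
    simp [density, statDist, Matrix.one_apply, ite_div]
    field_simp
  | succ t ih =>
    simp only [density_succ]
    rw [sum_dout_mul_lazyP_mulVec hloop heul hpos, ih]

/-- The variance, scaled by the number of edges, of the density at time `t`. -/
noncomputable def densityVar (E : V → V → Prop) [DecidableRel E] (t : ℕ) (y : V) : ℝ :=
  ∑ z, dout E z * (density E t y z - 1) ^ 2

lemma densityVar_eq (hloop : ∀ x, ¬ E x x) (heul : ∀ x, dout E x = din E x)
    (hpos : ∀ v, 0 < dout E v) (t : ℕ) (y : V) :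
    densityVar E t y = ∑ z, dout E z * density E t y z ^ 2 - numEdges E := by
  have h : ∀ z, dout E z * (density E t y z - 1) ^ 2 =
      dout E z * density E t y z ^ 2 - 2 * (dout E z * density E t y z) + dout E z :=
    fun z => by ring
  simp only [densityVar, h, sum_add_distrib, sum_sub_distrib, ← mul_sum]
  rw [sum_dout_mul_density hloop heul hpos, ← Nat.cast_sum, ← numEdges]
  ring

lemma densityVar_nonneg (t : ℕ) (y : V) : 0 ≤ densityVar E t y :=
  sum_nonneg fun _ _ => by positivity

/-- A Nash-type inequality: the variance controls the oscillation, hence the energy. -/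
lemma densityVar_sq_le (hloop : ∀ x, ¬ E x x) (heul : ∀ x, dout E x = din E x)
    (hconn : (SimpleGraph.fromRel E).Connected) (hm : 0 < numEdges E)
    (hpos : ∀ v, 0 < dout E v) (t : ℕ) (y : V) :
    (densityVar E t y / numEdges E) ^ 2 ≤
      Fintype.card V * edgeEnergy E (density E t y) := by
  have hm' : (0 : ℝ) < numEdges E := by exact_mod_cast hm
  have hsum := sum_dout_mul_density hloop heul hpos t y
  obtain ⟨a, -, ha⟩ := exists_max_image univ (density E t y) ⟨y, mem_univ y⟩
  obtain ⟨b, -, hb⟩ := exists_min_image univ (density E t y) ⟨y, mem_univ y⟩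
  refine le_trans ?_ (sq_sub_le_card_mul_edgeEnergy hconn (density E t y) a b)
  have h1 : ∑ z, dout E z * density E t y z ^ 2 ≤ density E t y a * numEdges E := by
    rw [← hsum, mul_sum]
    refine sum_le_sum fun z _ => ?_
    have h := mul_le_mul_of_nonneg_left (ha z (mem_univ z))
      (mul_nonneg (Nat.cast_nonneg (α := ℝ) (dout E z)) (density_nonneg (E := E) t y z))
    linarith
  have h2 : density E t y b * numEdges E ≤ numEdges E := by
    conv_rhs => rw [← hsum]
    rw [numEdges, Nat.cast_sum, mul_sum]
    refine sum_le_sum fun z _ => ?_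
    have h := mul_le_mul_of_nonneg_left (hb z (mem_univ z))
      (Nat.cast_nonneg (α := ℝ) (dout E z))
    linarith
  refine pow_le_pow_left₀ (div_nonneg (densityVar_nonneg t y) hm'.le) ?_ 2
  rw [div_le_iff₀ hm', densityVar_eq hloop heul hpos]
  linarith

/-- A sequence satisfying `u (t + 1) ≤ u t - u t ^ 2` decays like `1 / t`. -/
lemma nat_mul_le_one_of_le_sub_sq {u : ℕ → ℝ} (h0 : ∀ t, 0 ≤ u t)
    (h : ∀ t, u (t + 1) ≤ u t - u t ^ 2) (t : ℕ) : t * u t ≤ 1 := by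
  induction t with
  | zero => simp
  | succ t ih =>
    have h1 := h t
    have hu1 : u t ≤ 1 := by nlinarith [h0 t, h0 (t + 1)]
    have ht : (0 : ℝ) ≤ t := Nat.cast_nonneg _
    push_cast
    nlinarith [mul_le_mul_of_nonneg_left h1 (by linarith : (0 : ℝ) ≤ t + 1),
      mul_le_mul_of_nonneg_right ih (sub_nonneg.2 hu1), sq_nonneg (u t)]

lemma nat_mul_densityVar_le (hloop : ∀ x, ¬ E x x) (heul : ∀ x, dout E x = din E x)
    (hconn : (SimpleGraph.fromRel E).Connected) (hm : 0 < numEdges E)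
    (hpos : ∀ v, 0 < dout E v) (t : ℕ) (y : V) :
    t * (densityVar E t y / numEdges E) ≤ 4 * numEdges E * Fintype.card V := by
  have hm' : (0 : ℝ) < numEdges E := by exact_mod_cast hm
  have hn : (0 : ℝ) < Fintype.card V := by exact_mod_cast Fintype.card_pos_iff.2 ⟨y⟩
  have hK : (0 : ℝ) < 4 * numEdges E * Fintype.card V := by positivity
  have key := nat_mul_le_one_of_le_sub_sq
    (u := fun t => densityVar E t y / numEdges E / (4 * numEdges E * Fintype.card V))
    (fun t => div_nonneg (div_nonneg (densityVar_nonneg t y) hm'.le) hK.le) ?_ t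
  · rwa [← mul_div_assoc, div_le_one hK] at key
  · intro t
    have h1 := sum_dout_mul_sq_lazyP_mulVec_le hloop heul hpos (density E t y)
    simp only [← density_succ] at h1
    have h2 := densityVar_sq_le hloop heul hconn hm hpos t y
    have h3 : densityVar E (t + 1) y ≤
        densityVar E t y - edgeEnergy E (density E t y) / 4 := by
      rw [densityVar_eq hloop heul hpos, densityVar_eq hloop heul hpos]
      linarith
    have h4 : (densityVar E t y / numEdges E) ^ 2 / Fintype.card V ≤
        edgeEnergy E (density E t y) := by
      rw [div_le_iff₀ hn]
      linarith
    have h5 : densityVar E (t + 1) y ≤ densityVar E t y -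
        (densityVar E t y / numEdges E) ^ 2 / Fintype.card V / 4 := by linarith
    calc densityVar E (t + 1) y / numEdges E / (4 * numEdges E * Fintype.card V)
        ≤ (densityVar E t y - (densityVar E t y / numEdges E) ^ 2 / Fintype.card V / 4) /
            numEdges E / (4 * numEdges E * Fintype.card V) := by gcongr
      _ = _ := by field_simp

/-- Time reversal: reversing the edges of an Eulerian digraph reverses the walk. -/
lemma dout_mul_lazyP_pow (heul : ∀ x, dout E x = din E x) (hpos : ∀ v, 0 < dout E v)
    (t : ℕ) (x z : V) :
    dout E x * (lazyP E ^ t) x z = (lazyP (fun a b => E b a) ^ t) z x * dout E z := by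
  have hsemi : SemiconjBy (Matrix.diagonal fun v => (dout E v : ℝ)) (lazyP E)
      (lazyP fun a b => E b a).transpose := by
    ext x z
    rw [Matrix.diagonal_mul, Matrix.mul_diagonal, Matrix.transpose_apply]
    have hrev : dout (fun a b => E b a) z = dout E z := (heul z).symm
    have hx : (dout E x : ℝ) ≠ 0 := by exact_mod_cast (hpos x).ne'
    have hz : (dout E z : ℝ) ≠ 0 := by exact_mod_cast (hpos z).ne'
    unfold lazyP
    rw [hrev]
    by_cases h : x = z
    · subst h
      simp [mul_comm]
    · simp only [h, Ne.symm h, if_false]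
      split_ifs
      · field_simp
      · simp
  have h := congrFun (congrFun (hsemi.pow_right t).eq x) z
  rwa [Matrix.diagonal_mul, Matrix.mul_diagonal, ← Matrix.transpose_pow,
    Matrix.transpose_apply] at h

end EulerianWalk

/-- There is a positive constant `c1` such that for every connected Eulerian
digraph on `n` vertices and `m` directed edges, the lazy simple random walk satisfies
`t_unif ≤ c1·m·n`: for every integer `t ≥ c1·m·n` and all vertices `x, y`,
`|P^t(x,y)/π(y) − 1| ≤ 1/4`. -/
theorem eulerian_lazy_tunif_le_mn :
    ∃ c1 : ℝ, 0 < c1 ∧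
      ∀ (V : Type) [Fintype V] [DecidableEq V] (E : V → V → Prop) [DecidableRel E],
        (∀ x, ¬ E x x) →
        (∀ x, dout E x = din E x) →
        (SimpleGraph.fromRel E).Connected →
        0 < numEdges E →
        ∀ t : ℕ, c1 * (numEdges E : ℝ) * (Fintype.card V : ℝ) ≤ (t : ℝ) →
          ∀ x y : V, |(lazyP E ^ t) x y / statDist E y - 1| ≤ 1 / 4 := by
  refine ⟨40, by norm_num, ?_⟩
  intro V _ _ E _ hloop heul hconn hm t ht x y
  have hpos := dout_pos heul hconn hloop hm
  have hm' : (0 : ℝ) < numEdges E := by exact_mod_cast hm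
  have hmn : (1 : ℝ) ≤ numEdges E * Fintype.card V := by
    exact_mod_cast Nat.mul_pos hm (Fintype.card_pos_iff.2 ⟨y⟩)
  let R : V → V → Prop := fun a b => E b a
  have hdR : ∀ v, dout R v = dout E v := fun v => (heul v).symm
  have hmR : numEdges R = numEdges E := sum_congr rfl fun v _ => hdR v
  have heulR : ∀ v, dout R v = din R v := fun v => (heul v).symm
  have hconnR : (SimpleGraph.fromRel R).Connected := by
    convert hconn using 1
    ext a b
    simp only [SimpleGraph.fromRel_adj, R, or_comm]
  have hposR : ∀ v, 0 < dout R v := fun v => (hdR v).symm ▸ hpos v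
  obtain ⟨r, s, rfl, hr, hs⟩ : ∃ r s : ℕ, t = r + s ∧
      16 * ((numEdges E : ℝ) * Fintype.card V) ≤ r ∧
      16 * ((numEdges E : ℝ) * Fintype.card V) ≤ s := by
    have h1 : (t : ℝ) ≤ 2 * (t / 2 : ℕ) + 1 := by
      exact_mod_cast (by omega : t ≤ 2 * (t / 2) + 1)
    have h2 : ((t / 2 : ℕ) : ℝ) ≤ (t - t / 2 : ℕ) := by
      exact_mod_cast (by omega : t / 2 ≤ t - t / 2)
    exact ⟨t / 2, t - t / 2, by omega, by linarith, by linarith⟩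
  have hquarter : ∀ {u : ℕ} {W : ℝ}, 16 * ((numEdges E : ℝ) * Fintype.card V) ≤ u → 0 ≤ W →
      u * (W / numEdges E) ≤ 4 * numEdges E * Fintype.card V → W ≤ numEdges E / 4 := by
    intro u W hu hW h
    have h0 : 0 ≤ W / numEdges E := div_nonneg hW hm'.le
    have h1 : W / numEdges E ≤ 1 / 4 := by
      nlinarith [mul_le_mul_of_nonneg_right hu h0]
    rw [div_le_iff₀ hm'] at h1
    linarith
  have hA : densityVar R r x ≤ numEdges E / 4 :=
    hquarter hr (densityVar_nonneg r x)
      (hmR ▸ nat_mul_densityVar_le (E := R) hloop heulR hconnR (hmR.symm ▸ hm) hposR r x)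
  have hB : densityVar E s y ≤ numEdges E / 4 :=
    hquarter hs (densityVar_nonneg s y) (nat_mul_densityVar_le hloop heul hconn hm hpos s y)
  have hsplit : (lazyP E ^ (r + s)) x y / statDist E y - 1 =
      (∑ z, dout E z * ((density R r x z - 1) * (density E s y z - 1))) / numEdges E := by
    have hterm : ∀ z, (dout E z : ℝ) * ((density R r x z - 1) * (density E s y z - 1)) =
        dout E z * density R r x z * density E s y z - dout R z * density R r x z
          - dout E z * density E s y z + dout E z := fun z => by rw [hdR]; ring
    have hprod : ∀ z, (dout E z : ℝ) * density R r x z * density E s y z =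
        numEdges E * ((lazyP E ^ r) x z * (lazyP E ^ s) z y / statDist E y) := by
      intro z
      have hx : (dout E x : ℝ) ≠ 0 := by exact_mod_cast (hpos x).ne'
      have hrev := dout_mul_lazyP_pow heul hpos r x z
      have hdens : (dout E z : ℝ) * density R r x z = numEdges E * (lazyP E ^ r) x z := by
        unfold density statDist
        rw [hdR, hmR]
        field_simp
        linear_combination -hrev
      rw [hdens, density]
      ring
    simp only [hterm, sum_add_distrib, sum_sub_distrib]
    rw [sum_dout_mul_density hloop heul hpos, sum_dout_mul_density (E := R) hloop heulR hposR,
      hmR, ← Nat.cast_sum, ← numEdges]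
    simp only [hprod]
    rw [← mul_sum, ← sum_div, pow_add, Matrix.mul_apply]
    field_simp
    ring
  rw [hsplit, abs_div, abs_of_pos hm', div_le_iff₀ hm']
  refine (abs_sum_le_sum_abs _ _).trans ?_
  have hterm : ∀ z, |(dout E z : ℝ) * ((density R r x z - 1) * (density E s y z - 1))| ≤
      dout R z * (density R r x z - 1) ^ 2 / 2 + dout E z * (density E s y z - 1) ^ 2 / 2 := by
    intro z
    rw [hdR, abs_mul, abs_mul, Nat.abs_cast, ← sq_abs (density R r x z - 1),
      ← sq_abs (density E s y z - 1)]
    nlinarith [mul_nonneg (Nat.cast_nonneg (α := ℝ) (dout E z))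
      (sq_nonneg (|density R r x z - 1| - |density E s y z - 1|))]
  refine (sum_le_sum fun z _ => hterm z).trans ?_
  rw [sum_add_distrib, ← sum_div, ← sum_div]
  change densityVar R r x / 2 + densityVar E s y / 2 ≤ _
  linarith
end

section
/- There exists a positive constant c such that the following holds. Let G be a connected Eulerian digraph on n vertices and m directed edges, let X be the lazy simple random walk on G started at any vertex v0, and let (u_t)_{t≥0} be any deterministic sequence of vertices of G (a moving target). Define the collision time τ_col = inf{t ≥ 0 : X_t = u_t}. Then E_{v0}[τ_col] ≤ c·m·n·(1 + log(m/n)). Moreover, if G is d-regular, then E_{v0}[τ_col] ≤ c·n². -/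
open Finset

/-- The probability that a Markov chain with transition matrix `P` follows the trajectory
`x 0, x 1, …, x t` (given that it starts at `x 0`). -/
noncomputable def pathWeight {V : Type} [Fintype V] (P : Matrix V V ℝ) {t : ℕ}
    (x : Fin (t + 1) → V) : ℝ :=
  ∏ i : Fin t, P (x i.castSucc) (x i.succ)

/-- `collSurv P v0 u t` is the probability, for the chain with transition matrix `P` started at
`v0`, that the walk has not yet collided with the moving target `u` by time `t`, i.e.
`P_{v0}(X_s ≠ u_s for all 0 ≤ s ≤ t) = P_{v0}(τ_col > t)`. -/
noncomputable def collSurv {V : Type} [Fintype V] [DecidableEq V] (P : Matrix V V ℝ)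
    (v0 : V) (u : ℕ → V) (t : ℕ) : ℝ :=
  ∑ x : Fin (t + 1) → V,
    if x 0 = v0 ∧ ∀ s : Fin (t + 1), x s ≠ u (s : ℕ) then pathWeight P x else 0

/-! ### Survival probabilities -/

section Survival

variable {V : Type} [Fintype V] [DecidableEq V]

lemma collSurv_zero (P : Matrix V V ℝ) (v : V) (u : ℕ → V) :
    collSurv P v u 0 = if v = u 0 then 0 else 1 := by
  unfold collSurv pathWeight
  rw [← (Equiv.funUnique (Fin 1) V).symm.sum_comp]
  simp only [Equiv.funUnique_symm_apply, uniqueElim_const, Finset.univ_eq_empty,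
    Finset.prod_empty]
  rw [Finset.sum_eq_single v]
  · by_cases h : v = u 0 <;> simp [h]
  · intro b _ hb
    simp [hb]
  · simp

lemma collSurv_succ (P : Matrix V V ℝ) (v : V) (u : ℕ → V) (t : ℕ) :
    collSurv P v u (t + 1) =
      if v = u 0 then 0 else ∑ y, P v y * collSurv P y (fun s => u (s + 1)) t := by
  have key : collSurv P v u (t + 1) = ∑ x : Fin (t + 1) → V,
      if v ≠ u 0 ∧ ∀ s : Fin (t + 1), x s ≠ u ((s : ℕ) + 1) then
        P v (x 0) * pathWeight P x else 0 := by
    unfold collSurv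
    rw [← (Fin.consEquiv (fun _ => V)).sum_comp, Fintype.sum_prod_type, Finset.sum_eq_single v]
    · refine Finset.sum_congr rfl fun x _ => ?_
      simp [Fin.consEquiv, Fin.forall_fin_succ, pathWeight, Fin.prod_univ_succ]
    · intro b _ hb
      refine Finset.sum_eq_zero fun x _ => ?_
      simp [Fin.consEquiv, hb]
    · simp
  rw [key]
  split_ifs with h
  · simp [h]
  · unfold collSurv
    simp only [Finset.mul_sum]
    rw [Finset.sum_comm]
    refine Finset.sum_congr rfl fun x _ => ?_
    rw [Finset.sum_eq_single (x 0)]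
    · simp [h]
    · intro b _ hb
      simp [hb.symm]
    · simp

variable {P : Matrix V V ℝ}

lemma collSurv_nonneg (hP : ∀ x y, 0 ≤ P x y) (v : V) (u : ℕ → V) (t : ℕ) :
    0 ≤ collSurv P v u t := by
  unfold collSurv pathWeight
  refine Finset.sum_nonneg fun x _ => ?_
  split_ifs
  · exact Finset.prod_nonneg fun i _ => hP _ _
  · exact le_rfl

lemma collSurv_le_one (hP : ∀ x y, 0 ≤ P x y) (hP1 : ∀ x, ∑ y, P x y = 1) (v : V) (u : ℕ → V)
    (t : ℕ) : collSurv P v u t ≤ 1 := by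
  induction t generalizing v u with
  | zero => rw [collSurv_zero]; split_ifs <;> norm_num
  | succ t ih =>
    rw [collSurv_succ]
    split_ifs
    · norm_num
    · rw [← hP1 v]
      exact Finset.sum_le_sum fun y _ => mul_le_of_le_one_right (hP _ _) (ih _ _)

/-- A uniform bound on survival up to time `L` can be iterated by the Markov property. -/
lemma collSurv_add_le (hP : ∀ x y, 0 ≤ P x y) {L : ℕ} {q : ℝ}
    (hL : ∀ v u, collSurv P v u L ≤ q) (v : V) (u : ℕ → V) (t : ℕ) :
    collSurv P v u (t + L) ≤ q * collSurv P v u t := by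
  induction t generalizing v u with
  | zero =>
    rw [collSurv_zero, zero_add]
    split_ifs with h
    · cases L <;> simp [collSurv_zero, collSurv_succ, h]
    · simpa using hL v u
  | succ t ih =>
    rw [Nat.add_right_comm, collSurv_succ, collSurv_succ]
    split_ifs
    · simp
    · rw [Finset.mul_sum]
      refine Finset.sum_le_sum fun y _ => ?_
      calc _ ≤ P v y * (q * collSurv P y (fun s => u (s + 1)) t) :=
            mul_le_mul_of_nonneg_left (ih _ _) (hP _ _)
        _ = _ := by ring

/-- First-moment decomposition at the first collision: if the weighted number of collisions
after any collision is at most `K` in mean, then its mean is at most `K` times the collision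
probability. -/
lemma sum_collision_le (hP : ∀ x y, 0 ≤ P x y) (hP1 : ∀ x, ∑ y, P x y = 1) {w : V → ℝ} {K : ℝ}
    (N : ℕ)
    (hK : ∀ n ≤ N, ∀ (v : V) (u : ℕ → V) (a : ℕ),
      ∑ t ∈ range (n + 1), (if a ≤ t then (P ^ t) v (u t) * w (u t) else 0) ≤ K)
    (v : V) (u : ℕ → V) (a : ℕ) :
    ∑ t ∈ range (N + 1), (if a ≤ t then (P ^ t) v (u t) * w (u t) else 0) ≤
      K * (1 - collSurv P v u N) := by
  induction N generalizing v u a with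
  | zero =>
    rw [collSurv_zero]
    split_ifs with h
    · simpa using hK 0 le_rfl v u a
    · simp [h]
  | succ N ih =>
    rw [collSurv_succ]
    split_ifs with h
    · simpa using hK (N + 1) le_rfl v u a
    · have hstep : ∑ t ∈ range (N + 1 + 1), (if a ≤ t then (P ^ t) v (u t) * w (u t) else 0) =
          ∑ y, P v y * ∑ t ∈ range (N + 1),
            (if a - 1 ≤ t then (P ^ t) y (u (t + 1)) * w (u (t + 1)) else 0) := by
        rw [Finset.sum_range_succ']
        simp only [Finset.mul_sum]
        rw [Finset.sum_comm]
        simp only [pow_zero, Matrix.one_apply, h, if_false, zero_mul, ite_self, add_zero]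
        refine Finset.sum_congr rfl fun t _ => ?_
        have : a ≤ t + 1 ↔ a - 1 ≤ t := by omega
        simp only [this]
        split_ifs
        · rw [pow_succ', Matrix.mul_apply, Finset.sum_mul]
          exact Finset.sum_congr rfl fun y _ => by ring
        · simp
      rw [hstep]
      calc _ ≤ ∑ y, P v y * (K * (1 - collSurv P y (fun s => u (s + 1)) N)) :=
            Finset.sum_le_sum fun y _ => mul_le_mul_of_nonneg_left
              (ih (fun n hn => hK n (by omega)) y (fun s => u (s + 1)) (a - 1)) (hP _ _)
        _ = K * (∑ y, P v y - ∑ y, P v y * collSurv P y (fun s => u (s + 1)) N) := by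
            rw [← Finset.sum_sub_distrib, Finset.mul_sum]
            exact Finset.sum_congr rfl fun y _ => by ring
        _ = _ := by rw [hP1]

lemma pow_apply_nonneg (hP : ∀ x y, 0 ≤ P x y) (t : ℕ) (x y : V) : 0 ≤ (P ^ t) x y := by
  induction t generalizing x with
  | zero => rw [pow_zero, Matrix.one_apply]; split_ifs <;> norm_num
  | succ t ih =>
    rw [pow_succ', Matrix.mul_apply]
    exact Finset.sum_nonneg fun z _ => mul_nonneg (hP _ _) (ih _)

lemma pow_apply_le_one (hP : ∀ x y, 0 ≤ P x y) (hP1 : ∀ x, ∑ y, P x y = 1) (t : ℕ) (x y : V) :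
    (P ^ t) x y ≤ 1 := by
  induction t generalizing x with
  | zero => rw [pow_zero, Matrix.one_apply]; split_ifs <;> norm_num
  | succ t ih =>
    rw [pow_succ', Matrix.mul_apply, ← hP1 x]
    exact Finset.sum_le_sum fun z _ => mul_le_of_le_one_right (hP _ _) (ih _)

/-- Moving target bound from heat kernel estimates, `w` being the inverse of the stationary
distribution. -/
lemma sum_collSurv_le (hP : ∀ x y, 0 ≤ P x y) (hP1 : ∀ x, ∑ y, P x y = 1) {w : V → ℝ}
    (hw : ∀ y, 0 ≤ w y) {b : ℕ → ℝ} {T : ℕ} (hT : 0 < T)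
    (hb : ∀ r x y, (P ^ r) x y * w y ≤ b r)
    (hlow : ∀ r, T ≤ r → ∀ x y, 1 / 2 ≤ (P ^ r) x y * w y) (v : V) (u : ℕ → V) (N : ℕ) :
    ∑ t ∈ range N, collSurv P v u t ≤ 4 * ∑ r ∈ range (2 * T), b r := by
  set K := ∑ r ∈ range (2 * T), b r with hKdef
  have hb0 : ∀ r, 0 ≤ b r := fun r =>
    (mul_nonneg (pow_apply_nonneg hP r v v) (hw v)).trans (hb r v v)
  have hT' : (0 : ℝ) < T := by exact_mod_cast hT
  obtain ⟨L, hL⟩ : ∃ L, 2 * T = L + 1 := ⟨2 * T - 1, by omega⟩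
  have hcoll : ∀ v u, (T : ℝ) / 2 ≤ K * (1 - collSurv P v u L) := by
    intro v u
    refine le_trans ?_ (sum_collision_le hP hP1 (w := w) L ?_ v u T)
    · rw [← hL, two_mul, Finset.sum_range_add]
      calc (T : ℝ) / 2 = 0 + ∑ t ∈ range T, (1 / 2 : ℝ) := by simp; ring
        _ ≤ _ := by
          refine add_le_add (Finset.sum_nonneg fun t _ => ?_) (Finset.sum_le_sum fun t _ => ?_)
          · split_ifs
            · exact mul_nonneg (pow_apply_nonneg hP _ _ _) (hw _)
            · exact le_rfl
          · rw [if_pos (Nat.le_add_right _ _)]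
            exact hlow _ (Nat.le_add_right _ _) _ _
    · intro n hn v u a
      calc _ ≤ ∑ t ∈ range (n + 1), b t := by
            refine Finset.sum_le_sum fun t _ => ?_
            split_ifs
            · exact hb _ _ _
            · exact hb0 _
        _ ≤ K := Finset.sum_le_sum_of_subset_of_nonneg
            (Finset.range_subset_range.2 (by omega)) fun t _ _ => hb0 t
  have hK : 0 < K := by
    have h1 := hcoll v u
    have h2 := collSurv_nonneg hP v u L
    have h3 := collSurv_le_one hP hP1 v u L
    by_contra h
    nlinarith
  have hsurv : ∀ v u, collSurv P v u L ≤ 1 - T / (2 * K) := by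
    intro v u
    have h1 := hcoll v u
    have : (T : ℝ) / (2 * K) ≤ 1 - collSurv P v u L := by
      rw [div_le_iff₀ (by positivity)]
      linarith
    linarith
  set S := ∑ t ∈ range N, collSurv P v u t
  have hS : S ≤ L + (1 - T / (2 * K)) * S := by
    calc S ≤ ∑ t ∈ range (L + N), collSurv P v u t :=
          Finset.sum_le_sum_of_subset_of_nonneg (Finset.range_subset_range.2 (by omega))
            fun t _ _ => collSurv_nonneg hP _ _ _
      _ = ∑ t ∈ range L, collSurv P v u t + ∑ t ∈ range N, collSurv P v u (L + t) :=
          Finset.sum_range_add _ _ _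
      _ ≤ ∑ t ∈ range L, (1 : ℝ) + ∑ t ∈ range N, (1 - T / (2 * K)) * collSurv P v u t := by
          refine add_le_add (Finset.sum_le_sum fun t _ => collSurv_le_one hP hP1 _ _ _)
            (Finset.sum_le_sum fun t _ => ?_)
          rw [add_comm]
          exact collSurv_add_le hP hsurv v u t
      _ = _ := by simp [Finset.mul_sum, S]
  have hL' : (L : ℝ) ≤ 2 * T := by
    have : L ≤ 2 * T := by omega
    exact_mod_cast this
  have h4 : (T : ℝ) / (2 * K) * S ≤ 2 * T := by linarith
  rw [div_mul_eq_mul_div, div_le_iff₀ (by positivity)] at h4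
  nlinarith

end Survival

/-! ### Dirichlet energy of the lazy walk -/

section Energy

variable {V : Type} [Fintype V]

/-- The unnormalised Dirichlet energy of a function on a digraph. -/
def energy (E : V → V → Prop) [DecidableRel E] (h : V → ℝ) : ℝ :=
  ∑ x, ∑ y, if E x y then (h x - h y) ^ 2 else 0

variable {E : V → V → Prop} [DecidableRel E]

lemma sum_ite_edge_left (f : V → ℝ) :
    ∑ x, ∑ y, (if E x y then f x else 0) = ∑ x, (dout E x : ℝ) * f x := by
  refine Finset.sum_congr rfl fun x _ => ?_
  rw [← Finset.sum_filter, Finset.sum_const, nsmul_eq_mul, dout]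

lemma sum_ite_edge_right (hEul : ∀ x, dout E x = din E x) (f : V → ℝ) :
    ∑ x, ∑ y, (if E x y then f y else 0) = ∑ x, (dout E x : ℝ) * f x := by
  rw [Finset.sum_comm]
  refine Finset.sum_congr rfl fun x _ => ?_
  rw [← Finset.sum_filter, Finset.sum_const, nsmul_eq_mul, hEul, din]

lemma energy_nonneg (h : V → ℝ) : 0 ≤ energy E h :=
  Finset.sum_nonneg fun x _ => Finset.sum_nonneg fun y _ => by split_ifs <;> positivity

lemma sum_adj_le_energy (h : V → ℝ) [DecidableRel (SimpleGraph.fromRel E).Adj] :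
    ∑ x, ∑ y, (if (SimpleGraph.fromRel E).Adj x y then (h x - h y) ^ 2 else 0) ≤
      2 * energy E h := by
  have hswap : energy E h = ∑ x, ∑ y, if E y x then (h x - h y) ^ 2 else 0 := by
    unfold energy
    rw [Finset.sum_comm]
    refine Finset.sum_congr rfl fun x _ => Finset.sum_congr rfl fun y _ => ?_
    rw [← neg_sub, neg_sq]
  rw [two_mul]
  nth_rewrite 2 [hswap]
  unfold energy
  simp only [← Finset.sum_add_distrib]
  refine Finset.sum_le_sum fun x _ => Finset.sum_le_sum fun y _ => ?_
  have := sq_nonneg (h x - h y)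
  split_ifs with hadj <;>
    first
      | linarith
      | (rw [SimpleGraph.fromRel_adj] at hadj; tauto)

lemma exists_geodesic_to_compl {G : SimpleGraph V} (hG : G.Connected) {S : Finset V} {a b : V}
    (ha : a ∈ S) (hb : b ∉ S) :
    ∃ (k : ℕ) (v : ℕ → V), 0 < k ∧ v 0 = a ∧ v k ∉ S ∧ (∀ i < k, G.Adj (v i) (v (i + 1))) ∧
      (∀ i ≤ k, G.dist a (v i) = i) ∧ ∀ x, G.dist a x < k → x ∈ S := by
  classical
  obtain ⟨y, hy, hmin⟩ := Finset.exists_min_image Sᶜ (G.dist a) ⟨b, by simpa using hb⟩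
  simp only [Finset.mem_compl] at hy hmin
  obtain ⟨p, hp⟩ := hG.exists_walk_length_eq_dist a y
  refine ⟨p.length, p.getVert, ?_, p.getVert_zero, by simpa using hy,
    fun i hi => p.adj_getVert_succ hi, fun i hi => ?_, fun x hx => ?_⟩
  · rw [hp]
    exact hG.pos_dist_of_ne (by rintro rfl; exact hy ha)
  · have h1 : G.dist a (p.getVert i) ≤ i :=
      (SimpleGraph.dist_le (p.take i)).trans (by simp [SimpleGraph.Walk.take_length])
    have h2 : G.dist (p.getVert i) y ≤ p.length - i :=
      (SimpleGraph.dist_le (p.drop i)).trans (by simp [SimpleGraph.Walk.drop_length])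
    have h3 := hG.dist_triangle (u := a) (v := p.getVert i) (w := y)
    omega
  · by_contra h
    have := hmin x h
    omega

/-- Energy needed to leave a set `S`, in terms of the length of a shortest path out of `S`. -/
lemma exists_escape (hconn : (SimpleGraph.fromRel E).Connected) (hloop : ∀ x, ¬ E x x)
    (h : V → ℝ) {S : Finset V} {a b : V} (ha : a ∈ S) (hb : b ∉ S) :
    ∃ (k : ℕ) (z : V), z ∉ S ∧ (h a - h z) ^ 2 ≤ 2 * k * energy E h ∧ k ≤ #S ∧
      ∀ d, (∀ x, dout E x = d) → (k - 1) * d ≤ 3 * #S := by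
  classical
  obtain ⟨k, v, hk, hv0, hvk, hadj, hdist, hS⟩ := exists_geodesic_to_compl hconn ha hb
  have hinj : Set.InjOn v (range k) := by
    intro i hi j hj hij
    simp only [Finset.coe_range, Set.mem_Iio] at hi hj
    rw [← hdist i hi.le, ← hdist j hj.le, hij]
  refine ⟨k, v k, hvk, ?_, ?_, fun d hd => ?_⟩
  · have htel : h a - h (v k) = ∑ i ∈ range k, (h (v i) - h (v (i + 1))) := by
      rw [Finset.sum_range_sub' (fun i => h (v i)), hv0]
    have hpath : ∑ i ∈ range k, (h (v i) - h (v (i + 1))) ^ 2 ≤ 2 * energy E h := by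
      refine le_trans ?_ (sum_adj_le_energy h)
      calc _ ≤ ∑ i ∈ range k, ∑ y, (if (SimpleGraph.fromRel E).Adj (v i) y then
              (h (v i) - h y) ^ 2 else 0) := by
            refine Finset.sum_le_sum fun i hi => ?_
            refine le_trans ?_ (Finset.single_le_sum (fun y _ => ?_)
              (Finset.mem_univ (v (i + 1))))
            · rw [if_pos (hadj i (Finset.mem_range.1 hi))]
            · split_ifs <;> positivity
        _ = ∑ x ∈ (range k).image v, ∑ y, (if (SimpleGraph.fromRel E).Adj x y then
              (h x - h y) ^ 2 else 0) := by
            rw [Finset.sum_image hinj]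
        _ ≤ _ := Finset.sum_le_sum_of_subset_of_nonneg (Finset.subset_univ _) fun x _ _ =>
            Finset.sum_nonneg fun y _ => by split_ifs <;> positivity
    calc (h a - h (v k)) ^ 2 ≤ k * ∑ i ∈ range k, (h (v i) - h (v (i + 1))) ^ 2 := by
          rw [htel]
          simpa using sq_sum_le_card_mul_sum_sq (s := range k)
            (f := fun i => h (v i) - h (v (i + 1)))
      _ ≤ k * (2 * energy E h) := by gcongr
      _ = _ := by ring
  · calc k = #((range k).image v) := by rw [Finset.card_image_of_injOn hinj, Finset.card_range]
      _ ≤ #S := by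
        refine Finset.card_le_card fun x hx => ?_
        obtain ⟨i, hi, rfl⟩ := Finset.mem_image.1 hx
        rw [Finset.mem_range] at hi
        exact hS _ (by rwa [hdist i hi.le])
  · have hnear : ∀ i < k - 1, ∀ x, E (v i) x → (SimpleGraph.fromRel E).dist a x ≤ i + 1 ∧
        i ≤ (SimpleGraph.fromRel E).dist a x + 1 := by
      intro i hi x hx
      have hadj' : (SimpleGraph.fromRel E).Adj (v i) x := by
        rw [SimpleGraph.fromRel_adj]
        exact ⟨by rintro rfl; exact hloop _ hx, Or.inl hx⟩
      have h1 := hdist i (by omega)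
      have h2 := hconn.dist_triangle (u := a) (v := v i) (w := x)
      have h3 := hconn.dist_triangle (u := a) (v := x) (w := v i)
      have h4 := SimpleGraph.dist_eq_one_iff_adj.2 hadj'
      have h5 := SimpleGraph.dist_eq_one_iff_adj.2 hadj'.symm
      omega
    calc (k - 1) * d = ∑ i ∈ range (k - 1), #{x ∈ S | E (v i) x} := by
          rw [Finset.sum_congr rfl (g := fun _ => d), Finset.sum_const, Finset.card_range,
            smul_eq_mul]
          intro i hi
          rw [Finset.mem_range] at hi
          rw [← hd (v i), dout]
          congr 1
          ext x
          simp only [Finset.mem_filter, Finset.mem_univ, true_and, and_iff_right_iff_imp]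
          intro hx
          have := (hnear i hi x hx).1
          exact hS x (by omega)
      _ = ∑ x ∈ S, #{i ∈ range (k - 1) | E (v i) x} := by
          simp only [Finset.card_filter]
          exact Finset.sum_comm
      _ ≤ ∑ x ∈ S, 3 := by
          refine Finset.sum_le_sum fun x _ => ?_
          set δ := (SimpleGraph.fromRel E).dist a x
          calc _ ≤ #(Finset.Icc (δ - 1) (δ + 1)) := by
                refine Finset.card_le_card fun i hi => ?_
                rw [Finset.mem_filter, Finset.mem_range] at hi
                have := hnear i hi.1 x hi.2
                rw [Finset.mem_Icc]
                omega
            _ ≤ 3 := by rw [Nat.card_Icc]; omega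
      _ = 3 * #S := by rw [Finset.sum_const, smul_eq_mul, mul_comm]

/-- The variance of `h` under the stationary distribution, for `h` of mean one. -/
noncomputable def variance (E : V → V → Prop) [DecidableRel E] (h : V → ℝ) : ℝ :=
  (∑ x, (dout E x : ℝ) * (h x - 1) ^ 2) / numEdges E

lemma variance_nonneg (h : V → ℝ) : 0 ≤ variance E h :=
  div_nonneg (Finset.sum_nonneg fun x _ => by positivity) (by positivity)

lemma sum_dout : ∑ x, (dout E x : ℝ) = numEdges E := by
  simp [numEdges]

/-- A density of positive variance has a point `a` and a superlevel set `S` containing it, such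
that `h` drops from `S` to its complement by at least half of the variance, and `S` is small. -/
lemma exists_level_set {h : V → ℝ} (hm : 0 < numEdges E) (hpos : ∀ x, 0 < dout E x)
    (h0 : ∀ x, 0 ≤ h x) (h1 : ∑ x, (dout E x : ℝ) * h x = numEdges E) (hV : 0 < variance E h) :
    ∃ (S : Finset V) (a b : V), a ∈ S ∧ b ∉ S ∧ (∀ z ∉ S, variance E h / 2 ≤ h a - h z) ∧
      (∑ x ∈ S, (dout E x : ℝ)) * variance E h ≤ 2 * numEdges E := by
  classical
  have hm' : (0 : ℝ) < numEdges E := by exact_mod_cast hm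
  have hne : Nonempty V := by
    by_contra hV'
    rw [not_nonempty_iff] at hV'
    simp [numEdges] at hm
  obtain ⟨a, ha⟩ := Finite.exists_max h
  have hvar : variance E h ≤ h a - 1 := by
    unfold variance
    rw [div_le_iff₀ hm']
    calc ∑ x, (dout E x : ℝ) * (h x - 1) ^ 2
        = ∑ x, (dout E x : ℝ) * h x * h x - 2 * ∑ x, (dout E x : ℝ) * h x
            + ∑ x, (dout E x : ℝ) := by
          rw [Finset.mul_sum, ← Finset.sum_sub_distrib, ← Finset.sum_add_distrib]
          exact Finset.sum_congr rfl fun x _ => by ring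
      _ ≤ ∑ x, (dout E x : ℝ) * h x * h a - 2 * ∑ x, (dout E x : ℝ) * h x
            + ∑ x, (dout E x : ℝ) := by
          gcongr with x
          · exact mul_nonneg (by positivity) (h0 x)
          · exact ha x
      _ = _ := by
          rw [← Finset.sum_mul, h1, sum_dout]
          ring
  have hb : ∃ b, h b ≤ 1 := by
    by_contra! hlt
    have : ∑ x, (dout E x : ℝ) < ∑ x, (dout E x : ℝ) * h x :=
      Finset.sum_lt_sum_of_nonempty Finset.univ_nonempty fun x _ =>
        lt_mul_of_one_lt_right (by exact_mod_cast hpos x) (hlt x)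
    rw [h1, sum_dout] at this
    exact lt_irrefl _ this
  obtain ⟨b, hb⟩ := hb
  refine ⟨Finset.univ.filter fun x => (h a + 1) / 2 < h x, a, b, ?_, ?_, fun z hz => ?_, ?_⟩
  · simp only [Finset.mem_filter, Finset.mem_univ, true_and]
    linarith
  · simp only [Finset.mem_filter, Finset.mem_univ, true_and]
    linarith
  · simp only [Finset.mem_filter, Finset.mem_univ, true_and] at hz
    linarith
  · set S : Finset V := {x | (h a + 1) / 2 < h x}
    have h2 : (∑ x ∈ S, (dout E x : ℝ)) * ((h a + 1) / 2) ≤ numEdges E := by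
      rw [← h1, Finset.sum_mul]
      refine le_trans (Finset.sum_le_sum (g := fun x => (dout E x : ℝ) * h x) fun x hx => ?_)
        (Finset.sum_le_sum_of_subset_of_nonneg (Finset.subset_univ _)
          fun x _ _ => mul_nonneg (by positivity) (h0 x))
      exact mul_le_mul_of_nonneg_left (Finset.mem_filter.1 hx).2.le (by positivity)
    have h3 : 0 ≤ ∑ x ∈ S, (dout E x : ℝ) := Finset.sum_nonneg fun x _ => by positivity
    nlinarith

/-- Nash-type inequality governing long times. -/
lemma nash_sq {h : V → ℝ} (hconn : (SimpleGraph.fromRel E).Connected)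
    (hloop : ∀ x, ¬ E x x) (hm : 0 < numEdges E) (hpos : ∀ x, 0 < dout E x)
    (h0 : ∀ x, 0 ≤ h x) (h1 : ∑ x, (dout E x : ℝ) * h x = numEdges E) :
    variance E h ^ 2 ≤ 8 * Fintype.card V * energy E h := by
  have hE := energy_nonneg (E := E) h
  rcases (variance_nonneg (E := E) h).eq_or_lt with hV | hV
  · rw [← hV, zero_pow two_ne_zero]; positivity
  obtain ⟨S, a, b, ha, hb, hdrop, -⟩ := exists_level_set hm hpos h0 h1 hV
  obtain ⟨k, z, hz, hk, hkS, -⟩ := exists_escape hconn hloop h ha hb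
  have h2 := hdrop z hz
  have hkn : (k : ℝ) ≤ Fintype.card V := by exact_mod_cast hkS.trans (Finset.card_le_univ S)
  have h3 : (variance E h / 2) ^ 2 ≤ (h a - h z) ^ 2 := by gcongr
  have h4 : (k : ℝ) * energy E h ≤ Fintype.card V * energy E h := by gcongr
  nlinarith

/-- Nash-type inequality governing short times. -/
lemma nash_cube {h : V → ℝ} (hconn : (SimpleGraph.fromRel E).Connected)
    (hloop : ∀ x, ¬ E x x) (hm : 0 < numEdges E) (hpos : ∀ x, 0 < dout E x)
    (h0 : ∀ x, 0 ≤ h x) (h1 : ∑ x, (dout E x : ℝ) * h x = numEdges E) :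
    variance E h ^ 3 ≤ 16 * numEdges E * energy E h := by
  have hE := energy_nonneg (E := E) h
  rcases (variance_nonneg (E := E) h).eq_or_lt with hV | hV
  · rw [← hV, zero_pow three_ne_zero]; positivity
  obtain ⟨S, a, b, ha, hb, hdrop, hvol⟩ := exists_level_set hm hpos h0 h1 hV
  obtain ⟨k, z, hz, hk, hkS, -⟩ := exists_escape hconn hloop h ha hb
  have h2 := hdrop z hz
  have hkv : (k : ℝ) ≤ ∑ x ∈ S, (dout E x : ℝ) := by
    calc (k : ℝ) ≤ #S := by exact_mod_cast hkS
      _ = ∑ x ∈ S, (1 : ℝ) := by simp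
      _ ≤ _ := Finset.sum_le_sum fun x _ => by exact_mod_cast hpos x
  have h3 : (variance E h / 2) ^ 2 ≤ (h a - h z) ^ 2 := by gcongr
  have h4 : (k : ℝ) * variance E h ≤ 2 * numEdges E :=
    (mul_le_mul_of_nonneg_right hkv hV.le).trans hvol
  calc variance E h ^ 3 = 4 * ((variance E h / 2) ^ 2 * variance E h) := by ring
    _ ≤ 4 * (2 * k * energy E h * variance E h) := by gcongr; exact h3.trans hk
    _ = 8 * energy E h * (k * variance E h) := by ring
    _ ≤ 8 * energy E h * (2 * numEdges E) := by gcongr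
    _ = _ := by ring

/-- Nash-type inequality for regular digraphs. -/
lemma nash_cube_regular {h : V → ℝ} (hconn : (SimpleGraph.fromRel E).Connected)
    (hloop : ∀ x, ¬ E x x) (hm : 0 < numEdges E) (hpos : ∀ x, 0 < dout E x)
    (h0 : ∀ x, 0 ≤ h x) (h1 : ∑ x, (dout E x : ℝ) * h x = numEdges E)
    {d : ℕ} (hd : ∀ x, dout E x = d) :
    d * variance E h ^ 3 ≤ 80 * Fintype.card V * energy E h := by
  classical
  have hE := energy_nonneg (E := E) h
  rcases (variance_nonneg (E := E) h).eq_or_lt with hV | hV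
  · rw [← hV, zero_pow three_ne_zero, mul_zero]; positivity
  obtain ⟨S, a, b, ha, hb, hdrop, hvol⟩ := exists_level_set hm hpos h0 h1 hV
  have hd0 : (0 : ℝ) < d := by exact_mod_cast hd a ▸ hpos a
  have hm_eq : (numEdges E : ℝ) = Fintype.card V * d := by simp [← sum_dout, hd]
  have hcard : (#S : ℝ) * variance E h ≤ 2 * Fintype.card V := by
    have : (#S : ℝ) * d * variance E h ≤ 2 * (Fintype.card V * d) := by
      simpa [hd, hm_eq] using hvol
    nlinarith
  by_cases hSd : d ≤ 2 * #S
  · obtain ⟨k, z, hz, hk, hkS, hkd⟩ := exists_escape hconn hloop h ha hb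
    have h2 := hdrop z hz
    have h3 : (variance E h / 2) ^ 2 ≤ (h a - h z) ^ 2 := by gcongr
    have hkd' : (k : ℝ) * d ≤ 5 * #S := by
      have h5 := hkd d hd
      have : k * d ≤ 5 * #S := by
        rcases k with _ | k
        · simp
        · simp only [Nat.add_sub_cancel] at h5
          linarith [add_mul k 1 d]
      exact_mod_cast this
    calc d * variance E h ^ 3 = 4 * d * ((variance E h / 2) ^ 2 * variance E h) := by ring
      _ ≤ 4 * d * (2 * k * energy E h * variance E h) := by gcongr; exact h3.trans hk
      _ = 8 * energy E h * variance E h * (k * d) := by ring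
      _ ≤ 8 * energy E h * variance E h * (5 * #S) := by gcongr
      _ = 40 * energy E h * (#S * variance E h) := by ring
      _ ≤ 40 * energy E h * (2 * Fintype.card V) := by gcongr
      _ = _ := by ring
  · have hout : (d : ℝ) / 2 ≤ #{y | E a y ∧ y ∉ S} := by
      have hsub : d ≤ #{y | E a y ∧ y ∉ S} + #S := by
        rw [← hd a, dout]
        refine (Finset.card_le_card fun y hy => ?_).trans (Finset.card_union_le _ _)
        by_cases hyS : y ∈ S <;> simp_all
      have h6 : (d : ℝ) ≤ #{y | E a y ∧ y ∉ S} + #S := by exact_mod_cast hsub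
      have h7 : 2 * (#S : ℝ) < d := by exact_mod_cast not_le.1 hSd
      linarith
    have hEn : (d : ℝ) / 2 * (variance E h / 2) ^ 2 ≤ energy E h := by
      calc (d : ℝ) / 2 * (variance E h / 2) ^ 2
          ≤ #{y | E a y ∧ y ∉ S} * (variance E h / 2) ^ 2 := by gcongr
        _ = ∑ y ∈ {y | E a y ∧ y ∉ S}, (variance E h / 2) ^ 2 := by simp
        _ ≤ ∑ y ∈ {y | E a y ∧ y ∉ S}, (if E a y then (h a - h y) ^ 2 else 0) := by
            refine Finset.sum_le_sum fun y hy => ?_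
            obtain ⟨hay, hyS⟩ := (Finset.mem_filter.1 hy).2
            rw [if_pos hay]
            have := hdrop y hyS
            gcongr
        _ ≤ ∑ y, (if E a y then (h a - h y) ^ 2 else 0) :=
            Finset.sum_le_sum_of_subset_of_nonneg (Finset.subset_univ _)
              fun y _ _ => by split_ifs <;> positivity
        _ ≤ energy E h :=
            Finset.single_le_sum (f := fun x => ∑ y, if E x y then (h x - h y) ^ 2 else 0)
              (fun x _ => Finset.sum_nonneg fun y _ => by split_ifs <;> positivity)
              (Finset.mem_univ a)
    have hVn : variance E h ≤ 2 * Fintype.card V := by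
      have : (1 : ℝ) ≤ #S := by exact_mod_cast Finset.card_pos.2 ⟨a, ha⟩
      nlinarith
    calc d * variance E h ^ 3 = 8 * ((d : ℝ) / 2 * (variance E h / 2) ^ 2) * variance E h := by
          ring
      _ ≤ 8 * energy E h * (2 * Fintype.card V) := by gcongr
      _ ≤ _ := by nlinarith [mul_nonneg hE (Nat.cast_nonneg (α := ℝ) (Fintype.card V))]

end Energy

/-! ### The lazy walk on a connected Eulerian digraph -/

/-- A connected Eulerian digraph without loops and with at least one edge. -/
structure IsConnectedEulerian {V : Type} [Fintype V] (E : V → V → Prop) [DecidableRel E] :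
    Prop where
  loopless : ∀ x, ¬ E x x
  dout_eq_din : ∀ x, dout E x = din E x
  connected : (SimpleGraph.fromRel E).Connected
  numEdges_pos : 0 < numEdges E

namespace IsConnectedEulerian

variable {V : Type} [Fintype V] {E : V → V → Prop} [DecidableRel E]

lemma dout_flip (hE : IsConnectedEulerian E) (x : V) : dout (fun x y => E y x) x = dout E x :=
  (hE.dout_eq_din x).symm

lemma numEdges_flip (hE : IsConnectedEulerian E) :
    numEdges (fun x y => E y x) = numEdges E :=
  Finset.sum_congr rfl fun x _ => hE.dout_flip x

lemma flip (hE : IsConnectedEulerian E) : IsConnectedEulerian (fun x y => E y x) where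
  loopless := hE.loopless
  dout_eq_din x := (hE.dout_eq_din x).symm
  connected := by
    convert hE.connected using 1
    ext x y
    simp only [SimpleGraph.fromRel_adj, or_comm]
  numEdges_pos := hE.numEdges_flip ▸ hE.numEdges_pos

lemma dout_pos (hE : IsConnectedEulerian E) (x : V) : 0 < dout E x := by
  have hnt : Nontrivial V := by
    by_contra hV
    rw [not_nontrivial_iff_subsingleton] at hV
    have : numEdges E = 0 := Finset.sum_eq_zero fun a _ => by
      rw [dout, Finset.card_eq_zero, Finset.filter_eq_empty_iff]
      intro b _ hab
      exact hE.loopless a (Subsingleton.elim b a ▸ hab)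
    exact hE.numEdges_pos.ne' this
  obtain ⟨y, hy⟩ := hE.connected.preconnected.exists_adj_of_nontrivial x
  rw [SimpleGraph.fromRel_adj] at hy
  rcases hy.2 with h | h
  · exact Finset.card_pos.2 ⟨y, by simpa using h⟩
  · rw [hE.dout_eq_din]
    exact Finset.card_pos.2 ⟨y, by simpa using h⟩

lemma card_le_numEdges (hE : IsConnectedEulerian E) : Fintype.card V ≤ numEdges E := by
  calc Fintype.card V = ∑ x : V, 1 := by simp
    _ ≤ numEdges E := Finset.sum_le_sum fun x _ => hE.dout_pos x

lemma card_pos (hE : IsConnectedEulerian E) : 0 < Fintype.card V :=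
  Fintype.card_pos_iff.2 hE.connected.nonempty

variable [DecidableEq V]

lemma dout_mul_lazyP_mulVec (hE : IsConnectedEulerian E) (f : V → ℝ) (x : V) :
    (dout E x : ℝ) * (∑ y, lazyP E x y * f y) = ∑ y, if E x y then (f x + f y) / 2 else 0 := by
  have hd : (dout E x : ℝ) ≠ 0 := by exact_mod_cast (hE.dout_pos x).ne'
  have hP : ∀ y, lazyP E x y * f y =
      (if x = y then f y / 2 else 0) + (if E x y then f y else 0) / (2 * dout E x) := by
    intro y
    unfold lazyP
    by_cases hxy : x = y
    · subst hxy
      simp [hE.loopless x]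
      ring
    · by_cases h : E x y
      · simp [hxy, h]
        ring
      · simp [hxy, h]
  have hsplit : ∀ y, (if E x y then (f x + f y) / 2 else 0) =
      (if E x y then f x / 2 else 0) + (if E x y then f y else 0) / 2 := by
    intro y
    split_ifs <;> ring
  simp only [hP, hsplit, Finset.sum_add_distrib, ← Finset.sum_div]
  rw [Finset.sum_ite_eq, if_pos (Finset.mem_univ x), ← Finset.sum_filter (fun y => E x y)
    (fun _ => f x / 2), Finset.sum_const, nsmul_eq_mul, ← dout]
  field_simp

lemma lazyP_nonneg (x y : V) : 0 ≤ lazyP E x y := by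
  unfold lazyP
  split_ifs <;> positivity

lemma sum_lazyP (hE : IsConnectedEulerian E) (x : V) : ∑ y, lazyP E x y = 1 := by
  have hd : (dout E x : ℝ) ≠ 0 := by exact_mod_cast (hE.dout_pos x).ne'
  have h := hE.dout_mul_lazyP_mulVec (fun _ => 1) x
  rw [← Finset.sum_filter, Finset.sum_const, nsmul_eq_mul, ← dout] at h
  simp only [mul_one] at h
  exact mul_left_cancel₀ hd (by rw [h]; norm_num)

/-- The lazy walk on the reversed digraph is the time reversal of the lazy walk. -/
lemma dout_mul_pow_lazyP (hE : IsConnectedEulerian E) (t : ℕ) (x y : V) :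
    (dout E x : ℝ) * (lazyP E ^ t) x y =
      dout E y * (lazyP (fun x y => E y x) ^ t) y x := by
  have hstep : ∀ x y, (dout E x : ℝ) * lazyP E x y =
      dout E y * lazyP (fun x y => E y x) y x := by
    intro x y
    have hx : (dout E x : ℝ) ≠ 0 := by exact_mod_cast (hE.dout_pos x).ne'
    have hy : (dout E y : ℝ) ≠ 0 := by exact_mod_cast (hE.dout_pos y).ne'
    unfold lazyP
    rw [hE.dout_flip]
    by_cases hxy : x = y
    · simp [hxy]
    · by_cases h : E x y
      · simp only [hxy, Ne.symm hxy, h, if_true, if_false]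
        field_simp
      · simp [hxy, Ne.symm hxy, h]
  induction t generalizing y with
  | zero =>
    by_cases hxy : x = y
    · simp [hxy]
    · simp [Matrix.one_apply_ne hxy, Matrix.one_apply_ne (Ne.symm hxy)]
  | succ t ih =>
    rw [pow_succ, pow_succ', Matrix.mul_apply, Matrix.mul_apply, Finset.mul_sum, Finset.mul_sum]
    refine Finset.sum_congr rfl fun z _ => ?_
    rw [← mul_assoc, ih z, ← mul_assoc, ← hstep z y]
    ring

/-- The lazy walk preserves stationary means. -/
lemma sum_dout_mul_lazyP (hE : IsConnectedEulerian E) (f : V → ℝ) :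
    ∑ x, (dout E x : ℝ) * (∑ y, lazyP E x y * f y) = ∑ x, (dout E x : ℝ) * f x := by
  have hsplit : ∀ x y, (if E x y then (f x + f y) / 2 else 0) =
      (if E x y then f x else 0) / 2 + (if E x y then f y else 0) / 2 := by
    intro x y
    split_ifs <;> ring
  simp only [hE.dout_mul_lazyP_mulVec, hsplit, Finset.sum_add_distrib, ← Finset.sum_div]
  rw [sum_ite_edge_left, sum_ite_edge_right hE.dout_eq_din]
  ring

lemma sum_dout_mul_sq_lazyP_le (hE : IsConnectedEulerian E) (g : V → ℝ) :
    ∑ x, (dout E x : ℝ) * (∑ y, lazyP E x y * g y) ^ 2 ≤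
      ∑ x, (dout E x : ℝ) * g x ^ 2 - energy E g / 4 := by
  have hjensen : ∀ x, (dout E x : ℝ) * (∑ y, lazyP E x y * g y) ^ 2 ≤
      ∑ y, if E x y then ((g x + g y) / 2) ^ 2 else 0 := by
    intro x
    have hd : (0 : ℝ) < dout E x := by exact_mod_cast hE.dout_pos x
    have h := hE.dout_mul_lazyP_mulVec g x
    set q := ∑ y, lazyP E x y * g y
    rw [← Finset.sum_filter] at h ⊢
    have hcs := sq_sum_le_card_mul_sum_sq (s := univ.filter fun y => E x y)
      (f := fun y => (g x + g y) / 2)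
    rw [← h, ← dout, mul_pow, sq (dout E x : ℝ), mul_assoc] at hcs
    exact le_of_mul_le_mul_left hcs hd
  have hsplit : ∀ x y, (if E x y then ((g x + g y) / 2) ^ 2 else 0) =
      (if E x y then g x ^ 2 else 0) / 2 + (if E x y then g y ^ 2 else 0) / 2 -
        (if E x y then (g x - g y) ^ 2 else 0) / 4 := by
    intro x y
    split_ifs <;> ring
  refine (Finset.sum_le_sum fun x _ => hjensen x).trans (le_of_eq ?_)
  simp only [hsplit, Finset.sum_add_distrib, Finset.sum_sub_distrib, ← Finset.sum_div]
  rw [sum_ite_edge_left (fun x => g x ^ 2),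
    sum_ite_edge_right hE.dout_eq_din (fun x => g x ^ 2), energy]
  ring

lemma variance_lazyP_le (hE : IsConnectedEulerian E) (h : V → ℝ) :
    variance E (fun x => ∑ y, lazyP E x y * h y) ≤
      variance E h - energy E h / (4 * numEdges E) := by
  have hm : (0 : ℝ) < numEdges E := by exact_mod_cast hE.numEdges_pos
  have h1 := hE.sum_dout_mul_sq_lazyP_le (fun x => h x - 1)
  have h2 : ∀ x, ∑ y, lazyP E x y * (h y - 1) = ∑ y, lazyP E x y * h y - 1 := by
    intro x
    simp only [mul_sub, mul_one, Finset.sum_sub_distrib, hE.sum_lazyP]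
  have h3 : energy E (fun x => h x - 1) = energy E h := by simp [energy]
  simp only [h2, h3] at h1
  unfold variance
  rw [← div_div, ← sub_div]
  gcongr

/-- The density at time `t`, as a function of the starting point, of the lazy walk at `y`. -/
noncomputable def density (E : V → V → Prop) [DecidableRel E] (y : V) (t : ℕ) (x : V) : ℝ :=
  (lazyP E ^ t) x y * (numEdges E / dout E y)

lemma density_succ (y : V) (t : ℕ) :
    density E y (t + 1) = fun x => ∑ z, lazyP E x z * density E y t z := by
  ext x
  unfold density
  rw [pow_succ', Matrix.mul_apply, Finset.sum_mul]
  exact Finset.sum_congr rfl fun z _ => by ring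

lemma density_nonneg (y : V) (t : ℕ) (x : V) : 0 ≤ density E y t x :=
  mul_nonneg (pow_apply_nonneg lazyP_nonneg _ _ _) (by positivity)

lemma sum_dout_mul_density (hE : IsConnectedEulerian E) (y : V) (t : ℕ) :
    ∑ x, (dout E x : ℝ) * density E y t x = numEdges E := by
  induction t with
  | zero =>
    have hd : (dout E y : ℝ) ≠ 0 := by exact_mod_cast (hE.dout_pos y).ne'
    rw [Finset.sum_eq_single y]
    · simp only [density, pow_zero, Matrix.one_apply_eq]
      field_simp
    · intro x _ hx
      simp [density, Matrix.one_apply_ne hx]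
    · simp
  | succ t ih => rw [density_succ, hE.sum_dout_mul_lazyP, ih]

lemma density_le (hE : IsConnectedEulerian E) (y : V) (t : ℕ) (x : V) :
    density E y t x ≤ numEdges E / dout E y :=
  mul_le_of_le_one_left (by positivity)
    (pow_apply_le_one lazyP_nonneg hE.sum_lazyP _ _ _)

end IsConnectedEulerian

/-! ### Decay of sequences with superlinear contraction -/

lemma mul_le_of_sub_sq_div {v : ℕ → ℝ} {A : ℝ} (hA : 0 < A) (hv : ∀ t, 0 ≤ v t)
    (hstep : ∀ t, v (t + 1) ≤ v t - v t ^ 2 / A) (t : ℕ) : v t * t ≤ A := by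
  induction t with
  | zero => simpa using hA.le
  | succ t ih =>
    have h1 := hstep t
    have h2 := hv (t + 1)
    have h3 := hv t
    obtain ⟨x, hx⟩ : ∃ x, v t = A * x := ⟨v t / A, by field_simp⟩
    have h4 : v t ^ 2 / A = A * x ^ 2 := by rw [hx]; field_simp
    rw [h4, hx] at h1
    have hx0 : 0 ≤ x := by
      rw [hx] at h3
      exact nonneg_of_mul_nonneg_right h3 hA
    have hx1 : x * (t : ℝ) ≤ 1 := by
      rw [hx, mul_assoc] at ih
      exact le_of_mul_le_mul_left (by linarith) hA
    have hx2 : 0 ≤ x - x ^ 2 := nonneg_of_mul_nonneg_right (a := A) (by linarith) hA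
    push_cast
    calc v (t + 1) * (t + 1) ≤ (A * x - A * x ^ 2) * (t + 1) := by gcongr
      _ = A * ((x - x ^ 2) * (t + 1)) := by ring
      _ ≤ A * 1 := by
        gcongr
        rcases hx0.eq_or_lt with h | h
        · simp [← h]
        · have : 0 ≤ 1 - x := by
            refine nonneg_of_mul_nonneg_right (a := x) (by linarith [sq x, mul_sub x 1 x]) h
          nlinarith [mul_le_mul_of_nonneg_right hx1 this]
      _ = A := mul_one A

lemma sq_mul_le_of_sub_cube_div {v : ℕ → ℝ} {B : ℝ} (hB : 0 < B) (hv : ∀ t, 0 ≤ v t)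
    (hstep : ∀ t, v (t + 1) ≤ v t - v t ^ 3 / B) (t : ℕ) : v t ^ 2 * t ≤ B := by
  refine mul_le_of_sub_sq_div (v := fun t => v t ^ 2) hB (fun t => sq_nonneg _) (fun t => ?_) t
  have h1 := hstep t
  have h2 := hv (t + 1)
  have h3 := hv t
  have h4 : 0 ≤ v t ^ 3 / B := by positivity
  calc v (t + 1) ^ 2 ≤ v (t + 1) * v t := by nlinarith
    _ ≤ (v t - v t ^ 3 / B) * v t := by gcongr
    _ = v t ^ 2 - (v t ^ 2) ^ 2 / B := by ring

/-! ### Heat kernel bounds -/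

namespace IsConnectedEulerian

variable {V : Type} [Fintype V] [DecidableEq V] {E : V → V → Prop} [DecidableRel E]

lemma variance_density_succ_le (hE : IsConnectedEulerian E) (y : V) (t : ℕ) :
    variance E (density E y (t + 1)) ≤
      variance E (density E y t) - energy E (density E y t) / (4 * numEdges E) := by
  rw [density_succ]
  exact hE.variance_lazyP_le _

lemma variance_density_mul_le (hE : IsConnectedEulerian E) (y : V) (t : ℕ) :
    variance E (density E y t) * t ≤ 32 * numEdges E * Fintype.card V := by
  have hm : (0 : ℝ) < numEdges E := by exact_mod_cast hE.numEdges_pos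
  have hn : (0 : ℝ) < Fintype.card V := by exact_mod_cast hE.card_pos
  refine mul_le_of_sub_sq_div (v := fun t => variance E (density E y t)) (by positivity)
    (fun t => variance_nonneg _) (fun t => (hE.variance_density_succ_le y t).trans ?_) t
  have h := nash_sq hE.connected hE.loopless hE.numEdges_pos hE.dout_pos
    (density_nonneg y t) (hE.sum_dout_mul_density y t)
  gcongr _ - ?_
  rw [div_le_div_iff₀ (by positivity) (by positivity)]
  nlinarith

lemma variance_density_sq_mul_le (hE : IsConnectedEulerian E) (y : V) (t : ℕ) :
    variance E (density E y t) ^ 2 * t ≤ 64 * numEdges E ^ 2 := by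
  have hm : (0 : ℝ) < numEdges E := by exact_mod_cast hE.numEdges_pos
  refine sq_mul_le_of_sub_cube_div (v := fun t => variance E (density E y t)) (by positivity)
    (fun t => variance_nonneg _) (fun t => (hE.variance_density_succ_le y t).trans ?_) t
  have h := nash_cube hE.connected hE.loopless hE.numEdges_pos hE.dout_pos
    (density_nonneg y t) (hE.sum_dout_mul_density y t)
  gcongr _ - ?_
  rw [div_le_div_iff₀ (by positivity) (by positivity)]
  nlinarith

lemma variance_density_sq_mul_le_of_regular (hE : IsConnectedEulerian E) {d : ℕ}
    (hd : ∀ x, dout E x = d) (y : V) (t : ℕ) :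
    variance E (density E y t) ^ 2 * t ≤ 320 * Fintype.card V ^ 2 := by
  have hn : (0 : ℝ) < Fintype.card V := by exact_mod_cast hE.card_pos
  have hd0 : (0 : ℝ) < d := by exact_mod_cast hd y ▸ hE.dout_pos y
  have hm_eq : (numEdges E : ℝ) = Fintype.card V * d := by simp [← sum_dout, hd]
  refine sq_mul_le_of_sub_cube_div (v := fun t => variance E (density E y t)) (by positivity)
    (fun t => variance_nonneg _) (fun t => (hE.variance_density_succ_le y t).trans ?_) t
  have h := nash_cube_regular hE.connected hE.loopless hE.numEdges_pos hE.dout_pos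
    (density_nonneg y t) (hE.sum_dout_mul_density y t) hd
  gcongr _ - ?_
  rw [hm_eq, div_le_div_iff₀ (by positivity) (by positivity)]
  nlinarith

lemma density_add_sub_one_sq_le (hE : IsConnectedEulerian E) (x y : V) (s t : ℕ) :
    (density E y (s + t) x - 1) ^ 2 ≤
      variance (fun x y => E y x) (density (fun x y => E y x) x s) *
        variance E (density E y t) := by
  have hm : (numEdges E : ℝ) ≠ 0 := by exact_mod_cast hE.numEdges_pos.ne'
  have hx : (dout E x : ℝ) ≠ 0 := by exact_mod_cast (hE.dout_pos x).ne'
  set f := density (fun x y => E y x) x s with hf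
  set g := density E y t with hg
  have hf1 : ∑ z, (dout E z : ℝ) * f z = numEdges E := by
    have := hE.flip.sum_dout_mul_density x s
    simpa only [hE.dout_flip, hE.numEdges_flip] using this
  have hg1 : ∑ z, (dout E z : ℝ) * g z = numEdges E := hE.sum_dout_mul_density y t
  have hfg : ∑ z, (dout E z : ℝ) * f z * g z = numEdges E * density E y (s + t) x := by
    rw [density, pow_add, Matrix.mul_apply, Finset.sum_mul, Finset.mul_sum]
    refine Finset.sum_congr rfl fun z _ => ?_
    have h := hE.dout_mul_pow_lazyP s x z
    rw [hf, hg, density, density, hE.dout_flip, hE.numEdges_flip]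
    calc _ = (dout E z * (lazyP (fun x y => E y x) ^ s) z x) * (numEdges E / dout E x) *
          ((lazyP E ^ t) z y * (numEdges E / dout E y)) := by ring
      _ = _ := by
        rw [← h]
        field_simp
  have key : density E y (s + t) x - 1 =
      ∑ z, (dout E z : ℝ) * (f z - 1) * (g z - 1) / numEdges E := by
    have hexp : ∑ z, (dout E z : ℝ) * (f z - 1) * (g z - 1) =
        ∑ z, (dout E z : ℝ) * f z * g z - ∑ z, (dout E z : ℝ) * f z -
          ∑ z, (dout E z : ℝ) * g z + ∑ z, (dout E z : ℝ) := by
      simp only [← Finset.sum_sub_distrib, ← Finset.sum_add_distrib]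
      exact Finset.sum_congr rfl fun z _ => by ring
    rw [← Finset.sum_div, hexp, hf1, hg1, hfg, sum_dout]
    field_simp
    ring
  rw [key, variance, variance, Finset.sum_div, Finset.sum_div]
  simp only [hE.dout_flip, hE.numEdges_flip]
  refine Finset.sum_sq_le_sum_mul_sum_of_sq_le_mul _ (fun z _ => by positivity)
    (fun z _ => by positivity) fun z _ => le_of_eq ?_
  ring

lemma abs_density_sub_one_mul_le (hE : IsConnectedEulerian E) (x y : V) (r : ℕ) :
    |density E y r x - 1| * (r / 2 : ℕ) ≤ 32 * numEdges E * Fintype.card V := by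
  have h1 := hE.density_add_sub_one_sq_le x y (r / 2) (r - r / 2)
  rw [Nat.add_sub_cancel' (Nat.div_le_self r 2)] at h1
  have h2 := hE.flip.variance_density_mul_le x (r / 2)
  have h3 := hE.variance_density_mul_le y (r - r / 2)
  rw [hE.numEdges_flip] at h2
  have h4 : ((r / 2 : ℕ) : ℝ) ≤ (r - r / 2 : ℕ) := by
    have : r / 2 ≤ r - r / 2 := by omega
    exact_mod_cast this
  have ha := variance_nonneg (E := fun x y => E y x) (density (fun x y => E y x) x (r / 2))
  have hb := variance_nonneg (E := E) (density E y (r - r / 2))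
  set a := variance (fun x y => E y x) (density (fun x y => E y x) x (r / 2))
  set b := variance E (density E y (r - r / 2))
  refine le_of_sq_le_sq ?_ (by positivity)
  rw [mul_pow, sq_abs]
  have h5 : b * (r / 2 : ℕ) ≤ 32 * numEdges E * Fintype.card V := le_trans (by gcongr) h3
  calc _ ≤ a * b * ((r / 2 : ℕ) : ℝ) ^ 2 := by gcongr
    _ = (a * (r / 2 : ℕ)) * (b * (r / 2 : ℕ)) := by ring
    _ ≤ (32 * numEdges E * Fintype.card V) * (32 * numEdges E * Fintype.card V) :=
      mul_le_mul h2 h5 (by positivity) (by positivity)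
    _ = _ := by ring

/-- On-diagonal decay of the variance for both time directions gives off-diagonal decay. -/
lemma density_sub_one_sq_mul_le (hE : IsConnectedEulerian E) {B : ℝ} (hB : 0 ≤ B)
    (hfwd : ∀ y t, variance E (density E y t) ^ 2 * t ≤ B)
    (hbwd : ∀ y t, variance (fun x y => E y x) (density (fun x y => E y x) y t) ^ 2 * t ≤ B)
    (x y : V) (r : ℕ) : (density E y r x - 1) ^ 2 * (r / 2 : ℕ) ≤ B := by
  have h1 := hE.density_add_sub_one_sq_le x y (r / 2) (r - r / 2)
  rw [Nat.add_sub_cancel' (Nat.div_le_self r 2)] at h1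
  have h2 := hbwd x (r / 2)
  have h3 := hfwd y (r - r / 2)
  have h4 : ((r / 2 : ℕ) : ℝ) ≤ (r - r / 2 : ℕ) := by
    have : r / 2 ≤ r - r / 2 := by omega
    exact_mod_cast this
  have ha := variance_nonneg (E := fun x y => E y x) (density (fun x y => E y x) x (r / 2))
  have hb := variance_nonneg (E := E) (density E y (r - r / 2))
  set a := variance (fun x y => E y x) (density (fun x y => E y x) x (r / 2))
  set b := variance E (density E y (r - r / 2))
  refine le_of_sq_le_sq ?_ hB
  rw [mul_pow]
  have h5 : b ^ 2 * (r / 2 : ℕ) ≤ B := le_trans (by gcongr) h3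
  calc _ ≤ (a * b) ^ 2 * ((r / 2 : ℕ) : ℝ) ^ 2 := by gcongr
    _ = (a ^ 2 * (r / 2 : ℕ)) * (b ^ 2 * (r / 2 : ℕ)) := by ring
    _ ≤ B * B := mul_le_mul h2 h5 (by positivity) hB
    _ = B ^ 2 := by ring

end IsConnectedEulerian

/-! ### Summation of the heat kernel bounds -/

lemma sum_range_two_mul_half (f : ℕ → ℝ) (T : ℕ) :
    ∑ r ∈ range (2 * T), f (r / 2) = 2 * ∑ s ∈ range T, f s := by
  induction T with
  | zero => simp
  | succ T ih =>
    rw [show 2 * (T + 1) = 2 * T + 1 + 1 by ring, Finset.sum_range_succ, Finset.sum_range_succ, ih,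
      Finset.sum_range_succ, show (2 * T + 1) / 2 = T by omega, show 2 * T / 2 = T by omega]
    ring

lemma abs_le_div_sqrt_of_sq_mul_le {D C : ℝ} (hC : 0 ≤ C) {s : ℕ} (hs : s ≠ 0)
    (h : D ^ 2 * s ≤ C ^ 2) : |D| ≤ C / √s := by
  have hs' : 0 < √(s : ℝ) := Real.sqrt_pos.2 (by positivity)
  rw [le_div_iff₀ hs']
  refine le_of_sq_le_sq ?_ hC
  rwa [mul_pow, sq_abs, Real.sq_sqrt (by positivity)]

lemma sum_inv_sqrt_le (N : ℕ) : ∑ i ∈ range N, 1 / √((1 + i : ℕ) : ℝ) ≤ 2 * √N := by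
  induction N with
  | zero => simp
  | succ N ih =>
    rw [Finset.sum_range_succ, add_comm 1 N]
    have h1 : 0 ≤ √(N : ℝ) := Real.sqrt_nonneg _
    have h2 : 0 < √((N + 1 : ℕ) : ℝ) := Real.sqrt_pos.2 (by positivity)
    have h3 : √(N : ℝ) ^ 2 = N := Real.sq_sqrt (by positivity)
    have h4 : √((N + 1 : ℕ) : ℝ) ^ 2 = N + 1 := by
      rw [Real.sq_sqrt (by positivity)]
      push_cast
      ring
    have h5 : 1 / √((N + 1 : ℕ) : ℝ) ≤ 2 * √((N + 1 : ℕ) : ℝ) - 2 * √(N : ℝ) := by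
      rw [div_le_iff₀ h2]
      nlinarith [sq_nonneg (√((N + 1 : ℕ) : ℝ) - √(N : ℝ))]
    linarith

lemma sum_inv_le_log {a : ℕ} (ha : 0 < a) (k : ℕ) :
    ∑ i ∈ range k, 1 / ((1 + a + i : ℕ) : ℝ) ≤ Real.log (((a + k : ℕ) : ℝ) / a) := by
  have ha' : (0 : ℝ) < a := by exact_mod_cast ha
  induction k with
  | zero => simp
  | succ k ih =>
    rw [Finset.sum_range_succ]
    have h1 : (0 : ℝ) < (a + k : ℕ) := by exact_mod_cast (by omega : 0 < a + k)
    have h2 : (0 : ℝ) < (a + (k + 1) : ℕ) := by exact_mod_cast (by omega : 0 < a + (k + 1))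
    have h3 := Real.one_sub_inv_le_log_of_pos (div_pos h2 h1)
    have h4 : 1 / ((1 + a + k : ℕ) : ℝ) = 1 - (((a + (k + 1) : ℕ) : ℝ) / (a + k : ℕ))⁻¹ := by
      rw [inv_div]
      push_cast at h1 h2 ⊢
      have : (1 + a + k : ℝ) ≠ 0 := by linarith
      field_simp
      ring
    rw [Real.log_div h2.ne' ha'.ne']
    rw [Real.log_div h1.ne' ha'.ne'] at ih
    rw [Real.log_div h2.ne' h1.ne'] at h3
    linarith

namespace IsConnectedEulerian

variable {V : Type} [Fintype V] [DecidableEq V] {E : V → V → Prop} [DecidableRel E]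

/-- Moving target bound from a bound on the distance of the density to its limit. -/
lemma sum_collSurv_le_of_abs_density_sub_one_le (hE : IsConnectedEulerian E) {β : ℕ → ℝ} {T : ℕ}
    (hT : 0 < T) (hβ : ∀ r x y, |density E y r x - 1| ≤ β (r / 2))
    (hlow : ∀ r, T ≤ r → ∀ x y, |density E y r x - 1| ≤ 1 / 2) (v : V) (u : ℕ → V) (N : ℕ) :
    ∑ t ∈ range N, collSurv (lazyP E) v u t ≤ 8 * (T + ∑ s ∈ range T, β s) := by
  have h := sum_collSurv_le (P := lazyP E) lazyP_nonneg hE.sum_lazyP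
    (w := fun y => numEdges E / dout E y) (fun y => by positivity) (b := fun r => 1 + β (r / 2))
    hT (fun r x y => ?_) (fun r hr x y => ?_) v u N
  · rw [Finset.sum_add_distrib, sum_range_two_mul_half] at h
    simp only [Finset.sum_const, Finset.card_range, nsmul_eq_mul, mul_one] at h
    push_cast at h
    linarith
  · have h1 := (abs_le.1 (hβ r x y)).2
    rw [density] at h1
    linarith
  · have h1 := (abs_le.1 (hlow r hr x y)).1
    rw [density] at h1
    linarith

lemma abs_density_sub_one_le (hE : IsConnectedEulerian E) (x y : V) (r : ℕ) :
    |density E y r x - 1| ≤ numEdges E / dout E y := by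
  have h1 := hE.density_le y r x
  have h2 := density_nonneg (E := E) y r x
  have hd : (0 : ℝ) < dout E y := by exact_mod_cast hE.dout_pos y
  have h3 : (1 : ℝ) ≤ numEdges E / dout E y := by
    rw [le_div_iff₀ hd, one_mul]
    exact_mod_cast Finset.single_le_sum (f := dout E) (fun _ _ => Nat.zero_le _)
      (Finset.mem_univ y)
  rw [abs_le]
  constructor <;> linarith

lemma sum_collSurv_le_log (hE : IsConnectedEulerian E) (v : V) (u : ℕ → V) (N : ℕ) :
    ∑ t ∈ range N, collSurv (lazyP E) v u t ≤
      40000 * numEdges E * Fintype.card V *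
        (1 + Real.log (numEdges E / Fintype.card V)) := by
  have hn := hE.card_pos
  have hnm := hE.card_le_numEdges
  have hsq := hE.density_sub_one_sq_mul_le (B := 64 * numEdges E ^ 2) (by positivity)
    hE.variance_density_sq_mul_le
    (fun y t => by simpa only [hE.numEdges_flip] using hE.flip.variance_density_sq_mul_le y t)
  have hlin := hE.abs_density_sub_one_mul_le
  have htriv : ∀ (r : ℕ) (x y : V), |density E y r x - 1| ≤ numEdges E := fun r x y =>
    (hE.abs_density_sub_one_le x y r).trans
      (div_le_self (by positivity) (by exact_mod_cast hE.dout_pos y))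
  set m := numEdges E
  set n := Fintype.card V
  have hn' : (1 : ℝ) ≤ n := by exact_mod_cast hn
  have hnm' : (n : ℝ) ≤ m := by exact_mod_cast hnm
  have hm' : (0 : ℝ) < m := by linarith
  set T := 128 * (m * n) with hTdef
  have hTn : 1 + n ^ 2 ≤ T := by nlinarith
  obtain ⟨k, hk⟩ := Nat.exists_eq_add_of_le hTn
  have h := hE.sum_collSurv_le_of_abs_density_sub_one_le (T := T)
    (β := fun s => if s = 0 then (m : ℝ) else if s ≤ n ^ 2 then 8 * m / √s else 32 * m * n / s)
    (by omega) (fun r x y => ?_) (fun r hr x y => ?_) v u N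
  · refine h.trans ?_
    rw [hk, Finset.sum_range_add, Finset.sum_range_add, ← hk]
    have hA : ∑ i ∈ range (n ^ 2), (if 1 + i = 0 then (m : ℝ) else
        if 1 + i ≤ n ^ 2 then 8 * m / √((1 + i : ℕ) : ℝ) else 32 * m * n / (1 + i : ℕ)) ≤
        16 * (m * n) := by
      calc _ = 8 * m * ∑ i ∈ range (n ^ 2), 1 / √((1 + i : ℕ) : ℝ) := by
            rw [Finset.mul_sum]
            refine Finset.sum_congr rfl fun i hi => ?_
            rw [Finset.mem_range] at hi
            rw [if_neg (by omega), if_pos (by omega)]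
            ring
        _ ≤ 8 * m * (2 * √((n ^ 2 : ℕ) : ℝ)) := by
            gcongr
            exact sum_inv_sqrt_le _
        _ = _ := by
            rw [Nat.cast_pow, Real.sqrt_sq (by positivity)]
            ring
    have hlog : Real.log (((n ^ 2 + k : ℕ) : ℝ) / (n ^ 2 : ℕ)) ≤ 127 + Real.log (m / n) := by
      have h1 : ((n ^ 2 + k : ℕ) : ℝ) ≤ 128 * (m * n) := by
        exact_mod_cast (by omega : n ^ 2 + k ≤ 128 * (m * n))
      calc _ ≤ Real.log (128 * (m / n)) := by
            refine Real.log_le_log (by positivity) ?_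
            rw [div_le_iff₀ (by positivity)]
            refine h1.trans (le_of_eq ?_)
            push_cast
            field_simp
        _ = Real.log 128 + Real.log (m / n) := by
            rw [Real.log_mul (by norm_num) (by positivity)]
        _ ≤ _ := by
            have := Real.log_le_sub_one_of_pos (show (0 : ℝ) < 128 by norm_num)
            linarith
    have hB : ∑ i ∈ range k, (if 1 + n ^ 2 + i = 0 then (m : ℝ) else
        if 1 + n ^ 2 + i ≤ n ^ 2 then 8 * m / √((1 + n ^ 2 + i : ℕ) : ℝ) else
          32 * m * n / (1 + n ^ 2 + i : ℕ)) ≤ 32 * (m * n) * (127 + Real.log (m / n)) := by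
      calc _ = 32 * (m * n) * ∑ i ∈ range k, 1 / ((1 + n ^ 2 + i : ℕ) : ℝ) := by
            rw [Finset.mul_sum]
            refine Finset.sum_congr rfl fun i hi => ?_
            rw [if_neg (by omega), if_neg (by omega)]
            ring
        _ ≤ _ := by
            gcongr
            exact (sum_inv_le_log (by positivity) k).trans hlog
    have hl : 0 ≤ Real.log ((m : ℝ) / n) :=
      Real.log_nonneg (by rw [le_div_iff₀ (by linarith)]; linarith)
    have hmn : (m : ℝ) ≤ m * n := by nlinarith
    have hTr : (T : ℝ) = 128 * (m * n) := by rw [hTdef]; push_cast; ring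
    have hml : 0 ≤ (m : ℝ) * n * Real.log ((m : ℝ) / n) := by positivity
    rw [hTr]
    simp only [Finset.range_one, Finset.sum_singleton, if_true]
    nlinarith
  · have h1 := hsq x y r
    have h2 := hlin x y r
    split_ifs with hs hs2
    · exact htriv r x y
    · exact abs_le_div_sqrt_of_sq_mul_le (by positivity) hs (h1.trans_eq (by ring))
    · rwa [le_div_iff₀ (by positivity)]
  · have h2 := hlin x y r
    have hr2 : (64 * (m * n) : ℝ) ≤ (r / 2 : ℕ) := by
      exact_mod_cast (by omega : 64 * (m * n) ≤ r / 2)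
    have hmn : (0 : ℝ) < m * n := by positivity
    by_contra! hlt
    nlinarith

lemma sum_collSurv_le_of_regular (hE : IsConnectedEulerian E) {d : ℕ} (hd : ∀ x, dout E x = d)
    (v : V) (u : ℕ → V) (N : ℕ) :
    ∑ t ∈ range N, collSurv (lazyP E) v u t ≤ 40000 * (Fintype.card V : ℝ) ^ 2 := by
  have hn := hE.card_pos
  have hd0 : (0 : ℝ) < d := by exact_mod_cast hd v ▸ hE.dout_pos v
  have hsq := hE.density_sub_one_sq_mul_le (B := 320 * Fintype.card V ^ 2) (by positivity)
    (hE.variance_density_sq_mul_le_of_regular hd)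
    (hE.flip.variance_density_sq_mul_le_of_regular fun x => (hE.dout_flip x).trans (hd x))
  have htriv : ∀ (r : ℕ) (x y : V), |density E y r x - 1| ≤ Fintype.card V := by
    intro r x y
    refine (hE.abs_density_sub_one_le x y r).trans (le_of_eq ?_)
    rw [hd, ← sum_dout]
    simp only [hd, Finset.sum_const, Finset.card_univ, nsmul_eq_mul]
    field_simp
  set n := Fintype.card V
  have hn' : (1 : ℝ) ≤ n := by exact_mod_cast hn
  obtain ⟨k, hk⟩ : ∃ k, 2560 * n ^ 2 = 1 + k :=
    Nat.exists_eq_add_of_le (by nlinarith)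
  have h := hE.sum_collSurv_le_of_abs_density_sub_one_le (T := 2560 * n ^ 2)
    (β := fun s => if s = 0 then (n : ℝ) else 18 * n / √s)
    (by positivity) (fun r x y => ?_) (fun r hr x y => ?_) v u N
  · refine h.trans ?_
    have hk' : (k : ℝ) ≤ (51 * n) ^ 2 := by
      have : (2560 * n ^ 2 : ℝ) = 1 + k := by exact_mod_cast hk
      nlinarith
    have hA : ∑ i ∈ range k, (if 1 + i = 0 then (n : ℝ) else 18 * n / √((1 + i : ℕ) : ℝ)) ≤
        1836 * n ^ 2 := by
      calc _ = 18 * n * ∑ i ∈ range k, 1 / √((1 + i : ℕ) : ℝ) := by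
            rw [Finset.mul_sum]
            refine Finset.sum_congr rfl fun i hi => ?_
            rw [if_neg (by omega)]
            ring
        _ ≤ 18 * n * (2 * √k) := by
            gcongr
            exact sum_inv_sqrt_le _
        _ ≤ 18 * n * (2 * (51 * n)) := by
            gcongr
            exact Real.sqrt_le_iff.2 ⟨by positivity, hk'⟩
        _ = _ := by ring
    nth_rewrite 2 [hk]
    rw [Finset.sum_range_add]
    push_cast at hA ⊢
    simp only [Finset.range_one, Finset.sum_singleton, if_true]
    nlinarith
  · have h1 := hsq x y r
    split_ifs with hs
    · exact htriv r x y
    · refine abs_le_div_sqrt_of_sq_mul_le (by positivity) hs (h1.trans ?_)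
      nlinarith
  · have h1 := hsq x y r
    have hr2 : (1280 * n ^ 2 : ℝ) ≤ (r / 2 : ℕ) := by
      exact_mod_cast (by omega : 1280 * n ^ 2 ≤ r / 2)
    refine le_of_sq_le_sq ?_ (by norm_num)
    rw [sq_abs]
    have hn2 : (0 : ℝ) < n ^ 2 := by positivity
    by_contra! hlt
    nlinarith

end IsConnectedEulerian

/-- There is a positive constant `c` such that for every connected Eulerian
digraph on `n` vertices and `m` edges, every starting vertex `v0` and every moving target
`(u_t)`, the lazy simple random walk satisfies `E_{v0}[τ_col] ≤ c·m·n·(1 + log(m/n))`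
(expressed via `E[τ_col] = ∑_{t≥0} P(τ_col > t)`, bounded through all its partial sums);
moreover if the graph is `d`-regular then `E_{v0}[τ_col] ≤ c·n²`. -/
theorem eulerian_lazy_moving_target :
    ∃ c : ℝ, 0 < c ∧
      ∀ (V : Type) [Fintype V] [DecidableEq V] (E : V → V → Prop) [DecidableRel E],
        (∀ x, ¬ E x x) →
        (∀ x, dout E x = din E x) →
        (SimpleGraph.fromRel E).Connected →
        0 < numEdges E →
        ∀ (v0 : V) (u : ℕ → V),
          (∀ T : ℕ, ∑ t ∈ Finset.range T, collSurv (lazyP E) v0 u t ≤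
              c * (numEdges E : ℝ) * (Fintype.card V : ℝ) *
                (1 + Real.log ((numEdges E : ℝ) / (Fintype.card V : ℝ)))) ∧
          ((∃ d : ℕ, ∀ x, dout E x = d ∧ din E x = d) →
            ∀ T : ℕ, ∑ t ∈ Finset.range T, collSurv (lazyP E) v0 u t ≤
              c * (Fintype.card V : ℝ) ^ 2) := by
  refine ⟨40000, by norm_num, fun V _ _ E _ hloop hEul hconn hm v0 u => ?_⟩
  have hE : IsConnectedEulerian E := ⟨hloop, hEul, hconn, hm⟩
  exact ⟨hE.sum_collSurv_le_log v0 u,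
    fun ⟨d, hd⟩ => hE.sum_collSurv_le_of_regular (fun x => (hd x).1) v0 u⟩
end
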